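/- There exists a function f : ℕ → ℕ such that the following holds. Let A be a finite group isomorphic to the symmetric group S₄ on four symbols, let V be the normal subgroup of A isomorphic to the Klein four-group (the maximal normal 2-subgroup of A), and let α be an involution in A \ V. Suppose A acts by automorphisms on a finite group G in such a manner that C_G(V) = 1 and the centralizer C_G(α) has exponent dividing e. Then the exponent of G is at most f(e). -/

import Mathlib

section CommNil

theorem nil_comm_aux {S : Type*} [CommRing S] (X Z U W : S) (n : ℕ)
    (h1 : (X + Z) ^ n = 0) (h2 : (X ^ 2 + U) ^ n = 0) (h3 : (Z ^ 2 + W) ^ n = 0)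
    (h : X * W = Z * U) : (2 * X ^ 3) ^ (3 * n) = 0 := by
  have e : 2 * X ^ 3 = X * (Z ^ 2 + W) + (-Z) * (X ^ 2 + U)
      + (-(X * (X + Z - 3 * X))) * (X + Z) := by
    linear_combination (-1 : S) * h
  have k : ∀ c d : S, d ^ n = 0 → (c * d) ^ n = 0 := fun c d hd => by rw [mul_pow, hd, mul_zero]
  rw [e]
  have h12 := (Commute.all (X * (Z ^ 2 + W)) ((-Z) * (X ^ 2 + U))).add_pow_eq_zero_of_add_le_succ_of_pow_eq_zero
    (k _ _ h3) (k _ _ h2) (k := 2 * n) (by omega)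
  exact (Commute.all _ _).add_pow_eq_zero_of_add_le_succ_of_pow_eq_zero h12 (k _ _ h1) (by omega)

theorem nil_ring_aux {E : Type*} [Ring E] (X Z U W : E) (n : ℕ)
    (cXZ : X * Z = Z * X) (cXU : X * U = U * X) (cXW : X * W = W * X)
    (cZU : Z * U = U * Z) (cZW : Z * W = W * Z) (cUW : U * W = W * U)
    (h1 : (X + Z) ^ n = 0) (h2 : (X ^ 2 + U) ^ n = 0) (h3 : (Z ^ 2 + W) ^ n = 0)
    (h : X * W = Z * U) : (2 * X ^ 3) ^ (3 * n) = 0 := by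
  let s : Set E := {X, Z, U, W}
  have hc : ∀ x ∈ s, ∀ y ∈ s, x * y = y * x := by
    intro x hx y hy
    simp only [s, Set.mem_insert_iff, Set.mem_singleton_iff] at hx hy
    rcases hx with rfl | rfl | rfl | rfl <;> rcases hy with rfl | rfl | rfl | rfl <;> simp [*]
  letI := Subring.closureCommRingOfComm hc
  have mem : ∀ x ∈ s, x ∈ Subring.closure s := fun x hx => Subring.subset_closure hx
  let X' : Subring.closure s := ⟨X, mem _ (by simp [s])⟩
  let Z' : Subring.closure s := ⟨Z, mem _ (by simp [s])⟩
  let U' : Subring.closure s := ⟨U, mem _ (by simp [s])⟩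
  let W' : Subring.closure s := ⟨W, mem _ (by simp [s])⟩
  have := nil_comm_aux X' Z' U' W' n (Subtype.ext h1) (Subtype.ext h2) (Subtype.ext h3)
    (Subtype.ext h)
  exact congrArg Subtype.val this

theorem nil_on_aux {M : Type*} [AddCommGroup M] (D : Submodule ℤ M) (X Z U W : Module.End ℤ M)
    (n : ℕ) (sX : ∀ v ∈ D, X v ∈ D) (sZ : ∀ v ∈ D, Z v ∈ D) (sU : ∀ v ∈ D, U v ∈ D)
    (sW : ∀ v ∈ D, W v ∈ D)
    (cXZ : ∀ v ∈ D, X (Z v) = Z (X v)) (cXU : ∀ v ∈ D, X (U v) = U (X v))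
    (cXW : ∀ v ∈ D, X (W v) = W (X v)) (cZU : ∀ v ∈ D, Z (U v) = U (Z v))
    (cZW : ∀ v ∈ D, Z (W v) = W (Z v)) (cUW : ∀ v ∈ D, U (W v) = W (U v))
    (h1 : ∀ v ∈ D, ((X + Z) ^ n) v = 0) (h2 : ∀ v ∈ D, ((X ^ 2 + U) ^ n) v = 0)
    (h3 : ∀ v ∈ D, ((Z ^ 2 + W) ^ n) v = 0)
    (h : ∀ v ∈ D, X (W v) = Z (U v)) (two : ∀ v : M, (2 : ℤ) • v = 0 → v = 0) :
    ∀ v ∈ D, (X ^ (9 * n)) v = 0 := by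
  have key : ∀ (f : Module.End ℤ M) (g : Module.End ℤ D) (_ : ∀ v : D, (g v : M) = f v) (k : ℕ)
      (v : D), (((g ^ k) v : D) : M) = (f ^ k) v := by
    intro f g hg k
    induction k with
    | zero => intro v; simp
    | succ k ih => intro v; rw [pow_succ', pow_succ', Module.End.mul_apply, Module.End.mul_apply, hg, ih]
  let X' := X.restrict sX
  let Z' := Z.restrict sZ
  let U' := U.restrict sU
  let W' := W.restrict sW
  have := nil_ring_aux X' Z' U' W' n (by ext v; exact cXZ v v.2) (by ext v; exact cXU v v.2)
    (by ext v; exact cXW v v.2) (by ext v; exact cZU v v.2) (by ext v; exact cZW v v.2)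
    (by ext v; exact cUW v v.2)
    (by ext v; rw [key (X + Z) _ (fun v => rfl)]; exact h1 v v.2)
    (by ext v; rw [key (X ^ 2 + U) _ (fun v => rfl)]; exact h2 v v.2)
    (by ext v; rw [key (Z ^ 2 + W) _ (fun v => rfl)]; exact h3 v v.2)
    (by ext v; exact h v v.2)
  intro v hv
  have t := congrArg Subtype.val (LinearMap.congr_fun this ⟨v, hv⟩)
  rw [key (2 * X ^ 3) _ (fun v => by
    simp only [Module.End.mul_apply, pow_succ, pow_zero]; rfl)] at t
  have e : (2 * X ^ 3) ^ (3 * n) = (2 : ℤ) ^ (3 * n) • X ^ (9 * n) := by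
    rw [(Commute.ofNat_left 2 (X ^ 3)).mul_pow, ← pow_mul, zsmul_eq_mul]
    congr 1
    · push_cast; rfl
    · congr 1; ring
  rw [e] at t
  simp only [LinearMap.smul_apply] at t
  have : ∀ k : ℕ, ∀ w : M, (2 : ℤ) ^ k • w = 0 → w = 0 := by
    intro k
    induction k with
    | zero => intro w hw; simpa using hw
    | succ k ih => intro w hw; rw [pow_succ', mul_smul] at hw; exact ih w (two _ hw)
  exact this _ _ t

end CommNil

section Triple

variable {R : Type*} [LieRing R]

/-- Three commuting families of elements with brackets of two kinds landing in the third. -/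
structure Tri (A B C : AddSubgroup R) : Prop where
  aa : ∀ x ∈ A, ∀ y ∈ A, ⁅x, y⁆ = 0
  bb : ∀ x ∈ B, ∀ y ∈ B, ⁅x, y⁆ = 0
  cc : ∀ x ∈ C, ∀ y ∈ C, ⁅x, y⁆ = 0
  ab : ∀ x ∈ A, ∀ y ∈ B, ⁅x, y⁆ ∈ C
  bc : ∀ x ∈ B, ∀ y ∈ C, ⁅x, y⁆ ∈ A
  ca : ∀ x ∈ C, ∀ y ∈ A, ⁅x, y⁆ ∈ B

namespace Tri

variable {A B C : AddSubgroup R}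

theorem flip_mem {S : AddSubgroup R} {x y : R} (h : ⁅x, y⁆ ∈ S) : ⁅y, x⁆ ∈ S := by
  rw [← lie_skew]; exact S.neg_mem h

theorem swapAC (h : Tri A B C) : Tri C B A :=
  ⟨h.cc, h.bb, h.aa, fun x hx y hy => flip_mem (h.bc y hy x hx),
    fun x hx y hy => flip_mem (h.ab y hy x hx), fun x hx y hy => flip_mem (h.ca y hy x hx)⟩

theorem swapBC (h : Tri A B C) : Tri A C B :=
  ⟨h.aa, h.cc, h.bb, fun x hx y hy => flip_mem (h.ca y hy x hx),
    fun x hx y hy => flip_mem (h.bc y hy x hx), fun x hx y hy => flip_mem (h.ab y hy x hx)⟩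

theorem ac (h : Tri A B C) {x y : R} (hx : x ∈ A) (hy : y ∈ C) : ⁅x, y⁆ ∈ B :=
  flip_mem (h.ca y hy x hx)

theorem cb (h : Tri A B C) {x y : R} (hx : x ∈ C) (hy : y ∈ B) : ⁅x, y⁆ ∈ A :=
  flip_mem (h.bc y hy x hx)

theorem ba (h : Tri A B C) {x y : R} (hx : x ∈ B) (hy : y ∈ A) : ⁅x, y⁆ ∈ C :=
  flip_mem (h.ab y hy x hx)

theorem I1 (h : Tri A B C) {x x' : R} (hx : x ∈ A) (hx' : x' ∈ A) (u : R) :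
    ⁅x, ⁅x', u⁆⁆ = ⁅x', ⁅x, u⁆⁆ := by
  rw [leibniz_lie x x' u, h.aa x hx x' hx', zero_lie, zero_add]

theorem I2 (h : Tri A B C) {x x' z z' u : R} (hx : x ∈ A) (hx' : x' ∈ A) (hz : z ∈ C) (hz' : z' ∈ C)
    (hu : u ∈ B) : ⁅z, ⁅z', ⁅x, ⁅x', u⁆⁆⁆⁆ = ⁅⁅z, ⁅z', x⁆⁆, ⁅x', u⁆⁆ := by
  have hv : ⁅x', u⁆ ∈ C := h.ab _ hx' _ hu
  rw [leibniz_lie z' x, h.cc _ hz' _ hv, lie_zero, add_zero, leibniz_lie z ⁅z', x⁆,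
    h.cc _ hz _ hv, lie_zero, add_zero]

/-- The span of images of the two-step loops at `B`. -/
def D (A B C : AddSubgroup R) : Submodule ℤ R :=
  Submodule.span ℤ ({v | ∃ p ∈ A, ∃ p' ∈ A, ∃ u ∈ B, v = ⁅p, ⁅p', u⁆⁆} ∪
    {v | ∃ p ∈ C, ∃ p' ∈ C, ∃ u ∈ B, v = ⁅p, ⁅p', u⁆⁆})

theorem D_le (h : Tri A B C) {v : R} (hv : v ∈ D A B C) : v ∈ B := by
  induction hv using Submodule.span_induction with
  | mem v hv =>
    rcases hv with ⟨p, hp, p', hp', u, hu, rfl⟩ | ⟨p, hp, p', hp', u, hu, rfl⟩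
    · exact h.ac hp (h.ab _ hp' _ hu)
    · exact h.ca _ hp _ (h.cb hp' hu)
  | zero => exact B.zero_mem
  | add v w _ _ hv hw => exact B.add_mem hv hw
  | smul n v _ hv => exact B.zsmul_mem hv n

theorem memD_A {p p' u : R} (hp : p ∈ A) (hp' : p' ∈ A) (hu : u ∈ B) : ⁅p, ⁅p', u⁆⁆ ∈ D A B C :=
  Submodule.subset_span (Or.inl ⟨p, hp, p', hp', u, hu, rfl⟩)

theorem memD_C {p p' u : R} (hp : p ∈ C) (hp' : p' ∈ C) (hu : u ∈ B) : ⁅p, ⁅p', u⁆⁆ ∈ D A B C :=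
  Submodule.subset_span (Or.inr ⟨p, hp, p', hp', u, hu, rfl⟩)

theorem pq_aux (h : Tri A B C) {x x' z z' p p' u : R} (hx : x ∈ A) (hx' : x' ∈ A) (hz : z ∈ C)
    (hz' : z' ∈ C) (hp : p ∈ A) (hp' : p' ∈ A) (hu : u ∈ B) :
    ⁅x, ⁅x', ⁅z, ⁅z', ⁅p, ⁅p', u⁆⁆⁆⁆⁆⁆ = ⁅z, ⁅z', ⁅x, ⁅x', ⁅p, ⁅p', u⁆⁆⁆⁆⁆⁆ := by
  have hxu : ⁅x, ⁅x', u⁆⁆ ∈ B := h.ac hx (h.ab _ hx' _ hu)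
  have hr : ⁅z, ⁅z', p⁆⁆ ∈ A := h.cb hz (h.ca _ hz' _ hp)
  rw [h.I2 hp hp' hz hz' hu, h.I1 hx' hr, h.I1 hx hr, h.I1 hx' hp', h.I1 hx hp',
    ← h.I2 hp hp' hz hz' hxu, h.I1 hp' hx, h.I1 hp' hx', h.I1 hp hx, h.I1 hp hx']

theorem pq (h : Tri A B C) {x x' z z' v : R} (hx : x ∈ A) (hx' : x' ∈ A) (hz : z ∈ C)
    (hz' : z' ∈ C) (hv : v ∈ D A B C) :
    ⁅x, ⁅x', ⁅z, ⁅z', v⁆⁆⁆⁆ = ⁅z, ⁅z', ⁅x, ⁅x', v⁆⁆⁆⁆ := by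
  induction hv using Submodule.span_induction with
  | mem v hv =>
    rcases hv with ⟨p, hp, p', hp', u, hu, rfl⟩ | ⟨p, hp, p', hp', u, hu, rfl⟩
    · exact h.pq_aux hx hx' hz hz' hp hp' hu
    · exact (h.swapAC.pq_aux hz hz' hx hx' hp hp' hu).symm
  | zero => simp
  | add v w _ _ hv hw => simp only [lie_add, hv, hw]
  | smul n v _ hv => simp only [lie_zsmul, hv]

/-- abbreviation for the adjoint operator -/
abbrev ad (x : R) : Module.End ℤ R := LieAlgebra.ad ℤ R x

theorem pow_mem_of {M : Type*} [AddCommGroup M] (f : Module.End ℤ M) (B : AddSubgroup M)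
    (hf : ∀ v ∈ B, f v ∈ B) (k : ℕ) : ∀ v ∈ B, (f ^ k) v ∈ B := by
  induction k with
  | zero => intro v hv; simpa using hv
  | succ k ih => intro v hv; rw [pow_succ', Module.End.mul_apply]; exact hf _ (ih v hv)

theorem pow_congr_on {M : Type*} [AddCommGroup M] (f g : Module.End ℤ M) (B : AddSubgroup M)
    (hf : ∀ v ∈ B, f v ∈ B) (e : ∀ v ∈ B, f v = g v) (k : ℕ) :
    ∀ v ∈ B, (f ^ k) v = (g ^ k) v := by
  induction k with
  | zero => intro v hv; simp
  | succ k ih =>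
    intro v hv
    rw [pow_succ, Module.End.mul_apply, pow_succ, Module.End.mul_apply, ← e v hv]
    exact ih _ (hf v hv)

theorem sum_sq (h : Tri A B C) {x y : R} (hx : x ∈ A) (hy : y ∈ B) (q : ℕ) :
    ∀ v ∈ C, ((ad x ^ 2 + ad y ^ 2) ^ q) v = (ad (x + y) ^ (2 * q)) v := by
  rw [pow_mul]
  apply pow_congr_on
  · intro v hv
    simp only [LinearMap.add_apply, pow_two, Module.End.mul_apply, LieAlgebra.ad_apply]
    exact C.add_mem (h.ab _ hx _ (h.ac hx hv)) (h.ba hy (h.bc _ hy _ hv))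
  · intro v hv
    simp only [LinearMap.add_apply, pow_two, Module.End.mul_apply, LieAlgebra.ad_apply, add_lie,
      lie_add]
    rw [h.aa _ hx _ (h.bc _ hy _ hv), h.bb _ hy _ (h.ac hx hv)]
    abel

theorem U_eq (h : Tri A B C) {x y u : R} (hx : x ∈ A) (hy : y ∈ B) (hu : u ∈ B) :
    ⁅x, ⁅y, ⁅y, ⁅x, u⁆⁆⁆⁆ = -⁅⁅y, x⁆, ⁅⁅y, x⁆, u⁆⁆ := by
  have hw : ⁅y, x⁆ ∈ C := h.ba hy hx
  have hwu : ⁅⁅y, x⁆, u⁆ ∈ A := h.cb hw hu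
  have e1 : ⁅y, ⁅x, u⁆⁆ = ⁅⁅y, x⁆, u⁆ := by
    rw [leibniz_lie y x u, h.bb _ hy _ hu, lie_zero, add_zero]
  rw [e1, leibniz_lie x y, h.aa _ hx _ hwu, lie_zero, add_zero, ← lie_skew x y, neg_lie]

theorem I4 (h : Tri A B C) {x y z u : R} (hx : x ∈ A) (hy : y ∈ B) (hz : z ∈ C) (hu : u ∈ B) :
    ⁅⁅y, z⁆, ⁅x, u⁆⁆ = -⁅z, ⁅⁅y, x⁆, u⁆⁆ := by
  have hxu : ⁅x, u⁆ ∈ C := h.ab _ hx _ hu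
  have e1 : ⁅y, ⁅x, u⁆⁆ = ⁅⁅y, x⁆, u⁆ := by
    rw [leibniz_lie y x u, h.bb _ hy _ hu, lie_zero, add_zero]
  have := leibniz_lie y z ⁅x, u⁆
  rw [h.cc _ hz _ hxu, lie_zero, e1] at this
  exact eq_neg_of_add_eq_zero_left this.symm

theorem h2 (h : Tri A B C) {x y : R} (hx : x ∈ A) (hy : y ∈ B) (q : ℕ)
    (hq : ad (x + y) ^ (2 * q) = 0) :
    ∀ u ∈ B, (((ad x ^ 2) ^ 2 + -(ad ⁅y, x⁆ ^ 2)) ^ (q + 1)) u = 0 := by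
  set τ : Module.End ℤ R := ad x ^ 2 + ad y ^ 2 with hτ
  have τap : ∀ v, τ v = ⁅x, ⁅x, v⁆⁆ + ⁅y, ⁅y, v⁆⁆ := fun v => by
    simp only [hτ, LinearMap.add_apply, pow_two, Module.End.mul_apply, LieAlgebra.ad_apply]
  have τC : ∀ v ∈ C, τ v ∈ C := fun v hv => by
    rw [τap]; exact C.add_mem (h.ab _ hx _ (h.ac hx hv)) (h.ba hy (h.bc _ hy _ hv))
  have ξC : ∀ v ∈ C, (ad x ^ 2) v ∈ C := fun v hv => by
    simp only [pow_two, Module.End.mul_apply, LieAlgebra.ad_apply]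
    exact (h.ab _ hx _ (h.ac hx hv))
  have τD : ∀ v ∈ C, τ v ∈ D A C B := fun v hv => by
    rw [τap]; exact (D A C B).add_mem (memD_A hx hx hv) (memD_C hy hy hv)
  have comm : ∀ v ∈ C, τ ((ad x ^ 2) (τ v)) = (ad x ^ 2) (τ (τ v)) := by
    intro v hv
    have := h.swapBC.pq hx hx hy hy (τD v hv)
    generalize τ v = w at *
    rw [τap, τap]
    simp only [pow_two, Module.End.mul_apply, LieAlgebra.ad_apply, lie_add, this]
  have comm2 : ∀ k : ℕ, ∀ v ∈ C, (τ ^ (k + 1)) ((ad x ^ 2) (τ v)) = (ad x ^ 2) ((τ ^ (k + 2)) v) := by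
    intro k
    induction k with
    | zero => intro v hv; simpa [pow_two] using comm v hv
    | succ k ih =>
      intro v hv
      rw [pow_succ' τ (k + 1), Module.End.mul_apply, ih v hv]
      have e : (τ ^ (k + 2)) v = τ ((τ ^ (k + 1)) v) := by
        rw [pow_succ' τ (k + 1), Module.End.mul_apply]
      rw [e, comm _ (pow_mem_of τ C τC _ v hv), ← e, show k + 1 + 2 = (k + 2) + 1 from rfl,
        pow_succ' τ (k + 2), Module.End.mul_apply]
  have main : ∀ k : ℕ, ∀ v ∈ C, τ (((ad x ^ 2 * τ) ^ k) v) = ((ad x ^ 2) ^ k) ((τ ^ (k + 1)) v) := by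
    intro k
    induction k with
    | zero => intro v hv; simp
    | succ k ih =>
      intro v hv
      rw [pow_succ (ad x ^ 2 * τ), Module.End.mul_apply, Module.End.mul_apply,
        ih _ (ξC _ (τC _ hv)), comm2 k v hv, pow_succ (ad x ^ 2), Module.End.mul_apply]
  have zero : ∀ v ∈ C, (τ ^ q) v = 0 := fun v hv => by
    rw [hτ, h.sum_sq hx hy q v hv, hq]; rfl
  have conj : ∀ k : ℕ, ∀ u, ((ad x * τ * ad x) ^ (k + 1)) u
      = ad x (τ (((ad x ^ 2 * τ) ^ k) (ad x u))) := by
    intro k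
    induction k with
    | zero => intro u; simp [Module.End.mul_apply]
    | succ k ih =>
      intro u
      rw [pow_succ (ad x * τ * ad x), Module.End.mul_apply, ih, pow_succ (ad x ^ 2 * τ)]
      simp only [Module.End.mul_apply, pow_two]
  intro u hu
  have e := pow_congr_on ((ad x ^ 2) ^ 2 + -(ad ⁅y, x⁆ ^ 2)) (ad x * τ * ad x) B
    (fun v hv => by
      simp only [LinearMap.add_apply, LinearMap.neg_apply, pow_two, Module.End.mul_apply,
        LieAlgebra.ad_apply]
      have hw : ⁅y, x⁆ ∈ C := h.ba hy hx
      exact B.add_mem (h.ac hx (h.ab _ hx _ (h.ac hx (h.ab _ hx _ hv))))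
        (B.neg_mem (h.ca _ hw _ (h.cb hw hv))))
    (fun v hv => by
      have := h.U_eq hx hy hv
      simp only [LinearMap.add_apply, LinearMap.neg_apply, pow_two, Module.End.mul_apply,
        LieAlgebra.ad_apply, ← this, τap, lie_add]) (q + 1) u hu
  have hxu : ⁅x, u⁆ ∈ C := h.ab _ hx _ hu
  rw [e, conj, main _ _ (by simpa using hxu), pow_succ' τ, Module.End.mul_apply,
    zero _ (by simpa using hxu)]
  simp

theorem nilB (h : Tri A B C) {x y z : R} (hx : x ∈ A) (hy : y ∈ B) (hz : z ∈ C) (q : ℕ)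
    (hxy : ad (x + y) ^ (2 * q) = 0) (hyz : ad (y + z) ^ (2 * q) = 0)
    (hxz : ad (x + z) ^ (2 * q) = 0) (two : ∀ v : R, (2 : ℤ) • v = 0 → v = 0) :
    ∀ u ∈ B, (ad x ^ (18 * q + 20)) u = 0 := by
  have hw : ⁅y, x⁆ ∈ C := h.ba hy hx
  have hw' : ⁅y, z⁆ ∈ A := h.bc _ hy _ hz
  have DB : ∀ v ∈ D A B C, v ∈ B := fun v hv => h.D_le hv
  have key := nil_on_aux (D A B C) (ad x ^ 2) (ad z ^ 2) (-(ad ⁅y, x⁆ ^ 2)) (-(ad ⁅y, z⁆ ^ 2)) (q + 1)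
    (fun v hv => by
      simp only [pow_two, Module.End.mul_apply, LieAlgebra.ad_apply]
      exact memD_A hx hx (DB v hv))
    (fun v hv => by
      simp only [pow_two, Module.End.mul_apply, LieAlgebra.ad_apply]
      exact memD_C hz hz (DB v hv))
    (fun v hv => by
      simp only [LinearMap.neg_apply, pow_two, Module.End.mul_apply, LieAlgebra.ad_apply]
      exact (D A B C).neg_mem (memD_C hw hw (DB v hv)))
    (fun v hv => by
      simp only [LinearMap.neg_apply, pow_two, Module.End.mul_apply, LieAlgebra.ad_apply]
      exact (D A B C).neg_mem (memD_A hw' hw' (DB v hv)))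
    (fun v hv => by
      simp only [pow_two, Module.End.mul_apply, LieAlgebra.ad_apply]
      exact h.pq hx hx hz hz hv)
    (fun v hv => by
      simp only [LinearMap.neg_apply, pow_two, Module.End.mul_apply, LieAlgebra.ad_apply, lie_neg]
      rw [h.pq hx hx hw hw hv])
    (fun v hv => by
      simp only [LinearMap.neg_apply, pow_two, Module.End.mul_apply, LieAlgebra.ad_apply, lie_neg]
      rw [h.I1 hx hw', h.I1 hx hw', h.I1 hx hw', h.I1 hx hw'])
    (fun v hv => by
      simp only [LinearMap.neg_apply, pow_two, Module.End.mul_apply, LieAlgebra.ad_apply, lie_neg]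
      have h' := h.swapAC
      rw [h'.I1 hz hw, h'.I1 hz hw, h'.I1 hz hw, h'.I1 hz hw])
    (fun v hv => by
      simp only [LinearMap.neg_apply, pow_two, Module.End.mul_apply, LieAlgebra.ad_apply, lie_neg]
      rw [h.pq hw' hw' hz hz hv])
    (fun v hv => by
      simp only [LinearMap.neg_apply, pow_two, Module.End.mul_apply, LieAlgebra.ad_apply, lie_neg]
      rw [h.pq hw' hw' hw hw hv])
    (fun v hv => by
      rw [pow_succ', Module.End.mul_apply, h.swapBC.sum_sq hx hz q v (DB v hv), hxz]; simp)
    (fun v hv => h.h2 hx hy q hxy v (DB v hv))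
    (fun v hv => h.swapAC.h2 hz hy q (by rwa [add_comm]) v (DB v hv))
    (fun v hv => by
      simp only [LinearMap.neg_apply, pow_two, Module.End.mul_apply, LieAlgebra.ad_apply, lie_neg]
      have hv := DB v hv
      have h' := h.swapAC
      have a1 : ⁅x, ⁅x, ⁅⁅y, z⁆, ⁅⁅y, z⁆, v⁆⁆⁆⁆ = ⁅⁅y, z⁆, ⁅x, ⁅⁅y, z⁆, ⁅x, v⁆⁆⁆⁆ := by
        rw [h.I1 hw' hx v, h.I1 hw' hx, h.I1 hw' hx]
      have a2 : ⁅z, ⁅z, ⁅⁅y, x⁆, ⁅⁅y, x⁆, v⁆⁆⁆⁆ = ⁅z, ⁅⁅y, x⁆, ⁅z, ⁅⁅y, x⁆, v⁆⁆⁆⁆ := by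
        rw [h'.I1 hz hw (⁅⁅y, x⁆, v⁆)]
      have hv2 : ⁅z, ⁅⁅y, x⁆, v⁆⁆ ∈ B := h.ca _ hz _ (h.cb hw hv)
      rw [a1, a2, h.I4 hx hy hz hv, lie_neg, lie_neg, h.I4 hx hy hz hv2, neg_neg])
    two
  intro u hu
  have e : 18 * q + 20 = 2 * (9 * (q + 1)) + 2 := by ring
  rw [e, pow_add, Module.End.mul_apply, pow_mul]
  apply key
  simp only [pow_two, Module.End.mul_apply, LieAlgebra.ad_apply]
  exact memD_A hx hx hu

/-- Nilpotency of the adjoint operator on all three pieces. -/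
theorem nil_all (h : Tri A B C) {x y z : R} (hx : x ∈ A) (hy : y ∈ B) (hz : z ∈ C) (q : ℕ)
    (hxy : ad (x + y) ^ (2 * q) = 0) (hyz : ad (y + z) ^ (2 * q) = 0)
    (hxz : ad (x + z) ^ (2 * q) = 0) (two : ∀ v : R, (2 : ℤ) • v = 0 → v = 0) :
    ∀ u, u ∈ A ∨ u ∈ B ∨ u ∈ C → (ad x ^ (18 * q + 20)) u = 0 := by
  rintro u (hu | hu | hu)
  · rw [show 18 * q + 20 = 18 * q + 19 + 1 from rfl, pow_succ, Module.End.mul_apply,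
      LieAlgebra.ad_apply, h.aa _ hx _ hu, map_zero]
  · exact h.nilB hx hy hz q hxy hyz hxz two u hu
  · exact h.swapBC.nilB hx hz hy q hxz (by rwa [add_comm]) hxy two u hu

end Tri

end Triple

section FinThree

theorem f3a (a b : Fin 3) : -(a + -(a + b)) = b := by decide +revert
theorem f3b (a b : Fin 3) : -(b + -(a + b)) = a := by decide +revert
theorem f3c (a b : Fin 3) : -(-(a + b) + b) = a := by decide +revert
theorem f3d (a b : Fin 3) : -(-(a + b) + a) = b := by decide +revert
theorem f3e (a : Fin 3) : -(a + a) = a := by decide +revert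
theorem f3f (a b c : Fin 3) : a ≠ b → a ≠ c → b ≠ c → a = -(b + c) := by decide +revert
theorem f3g (a : Fin 3) : a ≠ a + 1 := by decide +revert
theorem f3h (a : Fin 3) : a ≠ a + 2 := by decide +revert
theorem f3i (a : Fin 3) : a + 1 ≠ a + 2 := by decide +revert
theorem f3j (a : Fin 3) : a + 2 = -(a + 1 + a) := by decide +revert
theorem f3k (a : Fin 3) : a + 1 = -(a + 2 + a) := by decide +revert
theorem f3l (a b : Fin 3) : b = a ∨ b = a + 1 ∨ b = a + 2 := by decide +revert

end FinThree

section Words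

variable {R : Type*} [LieRing R]

/-- A family of three subgroups with brackets as in the action of a four-group. -/
structure Typed (L : Fin 3 → AddSubgroup R) : Prop where
  mem : ∀ s t : Fin 3, ∀ x ∈ L s, ∀ y ∈ L t, ⁅x, y⁆ ∈ L (-(s + t))
  comm : ∀ s : Fin 3, ∀ x ∈ L s, ∀ y ∈ L s, ⁅x, y⁆ = 0

namespace Typed

variable {L : Fin 3 → AddSubgroup R}

theorem mem' (h : Typed L) {s t r : Fin 3} (e : r = -(s + t)) {x y : R} (hx : x ∈ L s)
    (hy : y ∈ L t) : ⁅x, y⁆ ∈ L r := e ▸ h.mem s t x hx y hy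

theorem tri (h : Typed L) {s t r : Fin 3} (h1 : s ≠ t) (h2 : t ≠ r) (h3 : r ≠ s) :
    Tri (L s) (L t) (L r) := by
  have e1 : r = -(s + t) := by decide +revert
  have e2 : s = -(t + r) := by decide +revert
  have e3 : t = -(r + s) := by decide +revert
  exact ⟨h.comm s, h.comm t, h.comm r, fun x hx y hy => h.mem' e1 hx hy,
    fun x hx y hy => h.mem' e2 hx hy, fun x hx y hy => h.mem' e3 hx hy⟩

theorem I1 (h : Typed L) {s : Fin 3} {x x' : R} (hx : x ∈ L s) (hx' : x' ∈ L s) (u : R) :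
    ⁅x, ⁅x', u⁆⁆ = ⁅x', ⁅x, u⁆⁆ := by
  rw [leibniz_lie x x' u, h.comm s x hx x' hx', zero_lie, zero_add]

/-- The descending chain of subgroups attached to `g`. -/
def H (L : Fin 3 → AddSubgroup R) (s t : Fin 3) (g : R) : ℕ → AddSubgroup R
  | 0 => L s
  | j + 1 => AddSubgroup.closure {v | ∃ w ∈ L t, ∃ u ∈ H L s t g j, v = ⁅g, ⁅w, u⁆⁆}

theorem H_le (h : Typed L) {s t : Fin 3} {g : R} (hg : g ∈ L t) (j : ℕ) : H L s t g j ≤ L s := by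
  induction j with
  | zero => exact le_refl _
  | succ j ih =>
    rw [H, AddSubgroup.closure_le]
    rintro v ⟨w, hw, u, hu, rfl⟩
    exact h.mem' (by simp only [f3a, f3b, f3c, f3d, f3e]) hg (h.mem t s w hw u (ih hu))

theorem H_stable (h : Typed L) {s t : Fin 3} {g : R} (hg : g ∈ L t) (j : ℕ) (r : Fin 3) (x x' : R)
    (hx : x ∈ L r) (hx' : x' ∈ L r) : ∀ u ∈ H L s t g j, ⁅x, ⁅x', u⁆⁆ ∈ H L s t g j := by
  induction j generalizing x x' with
  | zero =>
    intro u hu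
    exact h.mem' (by simp only [f3a, f3b, f3c, f3d, f3e]) hx (h.mem r s x' hx' u hu)
  | succ j ih =>
    intro u hu
    rw [H] at hu
    induction hu using AddSubgroup.closure_induction with
    | mem v hv =>
      obtain ⟨w, hw, u, hu, rfl⟩ := hv
      have hus := h.H_le hg j hu
      rw [H]
      by_cases hrs : r = s
      · subst hrs
        have h1 : ⁅g, ⁅w, u⁆⁆ ∈ L r :=
          h.mem' (by simp only [f3a, f3b, f3c, f3d, f3e]) hg (h.mem t r w hw u hus)
        rw [h.comm r _ hx' _ h1, lie_zero]
        exact AddSubgroup.zero_mem _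
      by_cases hrt : r = t
      · subst hrt
        rw [h.I1 hx' hg, h.I1 hx hg, h.I1 hx' hw, h.I1 hx hw]
        exact AddSubgroup.subset_closure ⟨w, hw, _, ih x x' hx hx' u hu, rfl⟩
      by_cases hst : s = t
      · subst hst
        rw [h.comm s _ hw _ hus, lie_zero, lie_zero, lie_zero]
        exact AddSubgroup.zero_mem _
      have T := h.tri (Ne.symm hst) (Ne.symm hrs) hrt
      have hw' : ⁅x, ⁅x', w⁆⁆ ∈ L t := T.cb hx (T.ca _ hx' _ hw)
      rw [h.I1 hg hw, T.I2 hw hg hx hx' hus, h.I1 hw' hg]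
      exact AddSubgroup.subset_closure ⟨_, hw', u, hu, rfl⟩
    | zero => simp
    | add v w _ _ hv hw => rw [lie_add, lie_add]; exact AddSubgroup.add_mem _ hv hw
    | neg v _ hv => rw [lie_neg, lie_neg]; exact AddSubgroup.neg_mem _ hv

theorem H_le_pow (h : Typed L) {s t : Fin 3} {g : R} (hg : g ∈ L t) (j : ℕ) :
    H L s t g j ≤ AddSubgroup.closure {v | ∃ r : Fin 3, ∃ u ∈ L r, v = (Tri.ad g ^ j) u} := by
  have cm : ∀ (w : R) (_ : w ∈ L t) (j : ℕ) (u : R),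
      ⁅w, (Tri.ad g ^ j) u⁆ = (Tri.ad g ^ j) ⁅w, u⁆ := by
    intro w hw j
    induction j with
    | zero => intro u; simp
    | succ j ih =>
      intro u
      rw [pow_succ', Module.End.mul_apply, Module.End.mul_apply, ← ih, LieAlgebra.ad_apply,
        LieAlgebra.ad_apply, h.I1 hw hg]
  induction j with
  | zero => intro u hu; exact AddSubgroup.subset_closure ⟨s, u, hu, by simp⟩
  | succ j ih =>
    rw [H, AddSubgroup.closure_le]
    rintro v ⟨w, hw, u, hu, rfl⟩
    have := ih hu
    clear hu
    change _ ∈ AddSubgroup.closure _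
    induction this using AddSubgroup.closure_induction with
    | mem v hv =>
      obtain ⟨r, u, hu, rfl⟩ := hv
      refine AddSubgroup.subset_closure ⟨_, ⁅w, u⁆, h.mem t r w hw u hu, ?_⟩
      rw [cm w hw, pow_succ', Module.End.mul_apply, LieAlgebra.ad_apply]
    | zero => simp
    | add v w _ _ hv hw => rw [lie_add, lie_add]; exact AddSubgroup.add_mem _ hv hw
    | neg v _ hv => rw [lie_neg, lie_neg]; exact AddSubgroup.neg_mem _ hv

theorem H_eq_bot (h : Typed L) {s t : Fin 3} {g : R} (hg : g ∈ L t) (m : ℕ)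
    (hm : ∀ r : Fin 3, ∀ u ∈ L r, (Tri.ad g ^ m) u = 0) (j : ℕ) (hj : m ≤ j) :
    H L s t g j = ⊥ := by
  rw [eq_bot_iff]
  refine (h.H_le_pow hg j).trans ?_
  rw [AddSubgroup.closure_le]
  rintro v ⟨r, u, hu, rfl⟩
  obtain ⟨k, rfl⟩ := Nat.exists_eq_add_of_le' hj
  rw [pow_add, Module.End.mul_apply, hm r u hu, map_zero]
  exact AddSubgroup.zero_mem _

/-- The states reachable from the chain. -/
def HH (L : Fin 3 → AddSubgroup R) (s t : Fin 3) (g : R) (j : ℕ) (σ : Fin 3) : AddSubgroup R :=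
  AddSubgroup.closure ({v | σ = s ∧ v ∈ H L s t g j} ∪
    {v | ∃ x ∈ L (-(s + σ)), ∃ u ∈ H L s t g j, v = ⁅x, u⁆})

theorem HH_letter (h : Typed L) {s t : Fin 3} {g : R} (hg : g ∈ L t) (j : ℕ) (σ τ : Fin 3) (y : R)
    (hy : y ∈ L τ) (v : R) (hv : v ∈ HH L s t g j σ) : ⁅y, v⁆ ∈ HH L s t g j (-(τ + σ)) := by
  rw [HH] at hv
  induction hv using AddSubgroup.closure_induction with
  | mem v hv =>
    rcases hv with ⟨rfl, hv⟩ | ⟨x, hx, u, hu, rfl⟩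
    · refine AddSubgroup.subset_closure (Or.inr ⟨y, ?_, v, hv, rfl⟩)
      have : -(σ + -(τ + σ)) = τ := by simp only [f3a, f3b, f3c, f3d, f3e]
      rwa [this]
    · have hus := h.H_le hg j hu
      have hxu : ⁅x, u⁆ ∈ L σ := h.mem' (by simp only [f3a, f3b, f3c, f3d, f3e]) hx hus
      by_cases h1 : τ = σ
      · subst h1
        rw [h.comm _ _ hy _ hxu]
        exact AddSubgroup.zero_mem _
      by_cases h2 : τ = s
      · subst h2
        rw [leibniz_lie, h.comm _ _ hy _ hus, lie_zero, add_zero]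
        refine AddSubgroup.subset_closure (Or.inr ⟨_, ?_, u, hu, rfl⟩)
        exact h.mem' (by simp only [f3a, f3b, f3c, f3d, f3e]) hy hx
      by_cases h3 : σ = s
      · subst h3
        have : -(σ + σ) = σ := by simp only [f3a, f3b, f3c, f3d, f3e]
        rw [this] at hx
        rw [h.comm _ _ hx _ hus, lie_zero]
        exact AddSubgroup.zero_mem _
      have h4 : τ = -(s + σ) := f3f _ _ _ h2 h1 (Ne.symm h3)
      subst h4
      refine AddSubgroup.subset_closure (Or.inl ⟨?_, ?_⟩)
      · simp only [f3a, f3b, f3c, f3d, f3e]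
      · exact h.H_stable hg j _ y x hy hx u hu
  | zero => simp
  | add v w _ _ hv hw => rw [lie_add]; exact AddSubgroup.add_mem _ hv hw
  | neg v _ hv => rw [lie_neg]; exact AddSubgroup.neg_mem _ hv

theorem HH_self (h : Typed L) {s t : Fin 3} {g : R} (hg : g ∈ L t) (j : ℕ) :
    HH L s t g j s = H L s t g j := by
  apply le_antisymm
  · rw [HH, AddSubgroup.closure_le]
    rintro v (⟨_, hv⟩ | ⟨x, hx, u, hu, rfl⟩)
    · exact hv
    · have : -(s + s) = s := by simp only [f3a, f3b, f3c, f3d, f3e]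
      rw [this] at hx
      rw [h.comm _ _ hx _ (h.H_le hg j hu)]
      exact AddSubgroup.zero_mem _
  · intro v hv
    exact AddSubgroup.subset_closure (Or.inl ⟨rfl, hv⟩)

theorem HH_le (h : Typed L) {s t : Fin 3} {g : R} (hg : g ∈ L t) (j : ℕ) (σ : Fin 3) :
    HH L s t g j σ ≤ L σ := by
  rw [HH, AddSubgroup.closure_le]
  rintro v (⟨rfl, hv⟩ | ⟨x, hx, u, hu, rfl⟩)
  · exact h.H_le hg j hv
  · exact h.mem' (by simp only [f3a, f3b, f3c, f3d, f3e]) hx (h.H_le hg j hu)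

theorem HH_bot {s t : Fin 3} {g : R} {j : ℕ} (σ : Fin 3) (hb : H L s t g j = ⊥) :
    HH L s t g j σ = ⊥ := by
  rw [eq_bot_iff, HH, AddSubgroup.closure_le, hb]
  rintro v (⟨rfl, hv⟩ | ⟨x, hx, u, hu, rfl⟩)
  · exact hv
  · rw [AddSubgroup.mem_bot] at hu
    simp [hu]

theorem HH_loop (h : Typed L) {s t : Fin 3} {g w : R} (hg : g ∈ L t) (hw : w ∈ L t) (j : ℕ)
    (v : R) (hv : v ∈ HH L s t g j s) : ⁅g, ⁅w, v⁆⁆ ∈ HH L s t g (j + 1) s := by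
  rw [h.HH_self hg] at hv ⊢
  exact AddSubgroup.subset_closure ⟨w, hw, v, hv, rfl⟩

/-- Right-normed words in the letters `𝒢`. -/
inductive Word (𝒢 : Finset (Fin 3 × R)) : ℕ → Fin 3 → R → Prop
  | base (p : Fin 3 × R) (hp : p ∈ 𝒢) : Word 𝒢 0 p.1 p.2
  | step (p : Fin 3 × R) (hp : p ∈ 𝒢) (n : ℕ) (σ : Fin 3) (v : R) (hv : Word 𝒢 n σ v) :
      Word 𝒢 (n + 1) (-(p.1 + σ)) ⁅p.2, v⁆

theorem word_mem (h : Typed L) {𝒢 : Finset (Fin 3 × R)} (h𝒢 : ∀ p ∈ 𝒢, p.2 ∈ L p.1) {n : ℕ}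
    {σ : Fin 3} {v : R} (hv : Word 𝒢 n σ v) : v ∈ L σ := by
  induction hv with
  | base p hp => exact h𝒢 p hp
  | step p hp n σ v _ ih => exact h.mem _ _ _ (h𝒢 p hp) _ ih

theorem update_aux {ι : Type*} [Fintype ι] [DecidableEq ι] (j : ι → ℕ) (c : ι) :
    ∑ i, Function.update j c (j c + 1) i = (∑ i, j i) + 1 := by
  rw [Finset.sum_update_of_mem (Finset.mem_univ c), ← Finset.add_sum_erase _ _ (Finset.mem_univ c),
    Finset.sdiff_singleton_eq_erase]
  ring

/-- Membership in all chains with prescribed counters. -/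
def Good (L : Fin 3 → AddSubgroup R) (𝒢 : Finset (Fin 3 × R)) (j : Fin 3 × 𝒢 → ℕ) (σ : Fin 3)
    (v : R) : Prop := ∀ c : Fin 3 × 𝒢, (j c = 0 ∧ v ∈ L σ) ∨ v ∈ HH L c.1 c.2.1.1 c.2.1.2 (j c) σ

theorem good_letter (h : Typed L) {𝒢 : Finset (Fin 3 × R)} (h𝒢 : ∀ p ∈ 𝒢, p.2 ∈ L p.1)
    {j : Fin 3 × 𝒢 → ℕ} {σ τ ρ : Fin 3} {v y : R} (hv : Good L 𝒢 j σ v) (hy : y ∈ L τ)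
    (e : ρ = -(τ + σ)) : Good L 𝒢 j ρ ⁅y, v⁆ := by
  subst e
  exact fun c => (hv c).imp (fun ⟨h0, hm⟩ => ⟨h0, h.mem _ _ _ hy _ hm⟩)
    (fun hm => h.HH_letter (h𝒢 _ c.2.2) _ _ _ _ hy _ hm)

theorem good_loop (h : Typed L) {𝒢 : Finset (Fin 3 × R)} (h𝒢 : ∀ p ∈ 𝒢, p.2 ∈ L p.1)
    {j : Fin 3 × 𝒢 → ℕ} {σ τ : Fin 3} {v y w : R} (hv : Good L 𝒢 j σ v) (hy : (τ, y) ∈ 𝒢)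
    (hw : w ∈ L τ) : ∃ j' : Fin 3 × 𝒢 → ℕ, ∑ c, j' c = (∑ c, j c) + 1 ∧
      Good L 𝒢 j' σ ⁅y, ⁅w, v⁆⁆ := by
  classical
  refine ⟨Function.update j (σ, ⟨(τ, y), hy⟩) (j (σ, ⟨(τ, y), hy⟩) + 1), update_aux _ _, ?_⟩
  intro c
  by_cases hc : c = (σ, ⟨(τ, y), hy⟩)
  · subst hc
    rw [Function.update_self]
    refine Or.inr (h.HH_loop (h𝒢 _ hy) hw _ _ ?_)
    rcases hv (σ, ⟨(τ, y), hy⟩) with ⟨h0, hm⟩ | hm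
    · rw [h0, h.HH_self (h𝒢 _ hy)]
      exact hm
    · exact hm
  · rw [Function.update_of_ne hc]
    exact h.good_letter h𝒢 (h.good_letter h𝒢 hv hw rfl) (h𝒢 _ hy) (by simp only [f3a, f3b, f3c, f3d, f3e]) c

theorem good_zero {𝒢 : Finset (Fin 3 × R)} (j : Fin 3 × 𝒢 → ℕ) (σ : Fin 3) (c0 : Fin 3 × 𝒢) :
    ∃ j' : Fin 3 × 𝒢 → ℕ, ∑ c, j' c = (∑ c, j c) + 1 ∧ Good L 𝒢 j' σ 0 := by
  classical
  exact ⟨Function.update j c0 (j c0 + 1), update_aux _ _, fun c => Or.inr (AddSubgroup.zero_mem _)⟩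

theorem good_three (h : Typed L) {𝒢 : Finset (Fin 3 × R)} (h𝒢 : ∀ p ∈ 𝒢, p.2 ∈ L p.1)
    {j : Fin 3 × 𝒢 → ℕ} {σ t1 t2 t3 : Fin 3} {v y1 y2 y3 : R} (hv : Good L 𝒢 j σ v)
    (hy1 : (t1, y1) ∈ 𝒢) (hy2 : (t2, y2) ∈ 𝒢) (hy3 : (t3, y3) ∈ 𝒢) :
    ∃ j' : Fin 3 × 𝒢 → ℕ, ∑ c, j' c = (∑ c, j c) + 1 ∧
      Good L 𝒢 j' (-(t3 + -(t2 + -(t1 + σ)))) ⁅y3, ⁅y2, ⁅y1, v⁆⁆⁆ := by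
  have hvσ : v ∈ L σ := by
    rcases hv (0, ⟨(t1, y1), hy1⟩) with ⟨_, hm⟩ | hm
    · exact hm
    · exact h.HH_le (h𝒢 _ hy1) _ _ hm
  have l1 := h𝒢 _ hy1
  have l2 := h𝒢 _ hy2
  have l3 := h𝒢 _ hy3
  simp only at l1 l2 l3
  have m1 : ⁅y1, v⁆ ∈ L (-(t1 + σ)) := h.mem _ _ _ l1 _ hvσ
  have m2 : ⁅y2, ⁅y1, v⁆⁆ ∈ L (-(t2 + -(t1 + σ))) := h.mem _ _ _ l2 _ m1
  by_cases c1 : t1 = σ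
  · subst c1
    rw [h.comm _ _ l1 _ hvσ, lie_zero, lie_zero]
    exact good_zero j _ (0, ⟨_, hy1⟩)
  by_cases c2 : t2 = t1
  · subst c2
    obtain ⟨j', hj', hg⟩ := h.good_loop h𝒢 hv hy2 l1
    exact ⟨j', hj', h.good_letter h𝒢 hg l3 (by simp only [f3a, f3b, f3c, f3d, f3e])⟩
  by_cases c3 : t2 = σ
  · subst c3
    by_cases c4 : t3 = t1
    · subst c4
      have : -(t2 + -(t3 + t2)) = t3 := by simp only [f3a, f3b, f3c, f3d, f3e]
      rw [this] at m2
      rw [h.comm _ _ l3 _ m2]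
      exact good_zero j _ (0, ⟨_, hy1⟩)
    by_cases c5 : t3 = t2
    · subst c5
      obtain ⟨j', hj', hg⟩ := h.good_loop h𝒢 (h.good_letter h𝒢 hv l1 rfl) hy3 l2
      refine ⟨j', hj', ?_⟩
      convert hg using 1
      rw [f3a]
    · rw [leibniz_lie y2 y1 v, h.comm _ _ l2 _ hvσ, lie_zero, add_zero]
      have e3 : -(t3 + t1) = t2 := by
        rw [f3f t3 t2 t1 c5 c4 c2, f3c]
      obtain ⟨j', hj', hg⟩ := h.good_loop h𝒢 hv hy3
        (h.mem' (f3f t3 t2 t1 c5 c4 c2) l2 l1)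
      refine ⟨j', hj', ?_⟩
      convert hg using 1
      simp only [f3a, f3b, f3c, f3d, f3e, e3]
  · have c6 : -(t1 + σ) = t2 := (f3f t2 t1 σ c2 c3 c1).symm
    rw [c6] at m1
    rw [h.comm _ _ l2 _ m1, lie_zero]
    exact good_zero j _ (0, ⟨_, hy1⟩)

theorem word_good (h : Typed L) {𝒢 : Finset (Fin 3 × R)} (h𝒢 : ∀ p ∈ 𝒢, p.2 ∈ L p.1) (k : ℕ) :
    ∀ (σ : Fin 3) (v : R), Word 𝒢 (3 * k) σ v →
    ∃ j : Fin 3 × 𝒢 → ℕ, ∑ c, j c = k ∧ Good L 𝒢 j σ v := by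
  induction k with
  | zero =>
    intro σ v hv
    have hvσ := h.word_mem h𝒢 hv
    exact ⟨fun _ => 0, by simp, fun c => Or.inl ⟨rfl, hvσ⟩⟩
  | succ k ih =>
    intro σ v hv
    cases hv with
    | step p3 hp3 n σ3 v hv =>
      cases hv with
      | step p2 hp2 n σ3 v hv =>
        cases hv with
        | step p1 hp1 n σ3 v hv =>
          obtain ⟨j, hj, hg⟩ := ih _ _ hv
          obtain ⟨j', hj', hg'⟩ := h.good_three h𝒢 hg hp1 hp2 hp3
          exact ⟨j', by rw [hj', hj], hg'⟩

theorem word_zero (h : Typed L) {𝒢 : Finset (Fin 3 × R)} (h𝒢 : ∀ p ∈ 𝒢, p.2 ∈ L p.1) (m d : ℕ)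
    (hd : 𝒢.card ≤ d)
    (hm : ∀ p ∈ 𝒢, ∀ r : Fin 3, ∀ u ∈ L r, (Tri.ad p.2 ^ m) u = 0)
    {σ : Fin 3} {v : R} (hv : Word 𝒢 (3 * (3 * d * m + 1)) σ v) : v = 0 := by
  obtain ⟨j, hj, hg⟩ := h.word_good h𝒢 _ σ v hv
  have : ∃ c, m ≤ j c ∧ 0 < j c := by
    by_contra! hc
    have : ∑ c, j c ≤ ∑ _c : Fin 3 × 𝒢, m := Finset.sum_le_sum (fun c _ => by
      have := hc c; omega)
    simp only [Finset.sum_const, Finset.card_univ, Fintype.card_prod, Fintype.card_fin,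
      Fintype.card_coe, smul_eq_mul] at this
    have h2 : 3 * 𝒢.card * m ≤ 3 * d * m := by gcongr
    omega
  obtain ⟨c, hc, hc0⟩ := this
  rcases hg c with ⟨h0, _⟩ | hm'
  · omega
  · rw [HH_bot σ (h.H_eq_bot (h𝒢 _ c.2.2) m (hm _ c.2.2) _ hc)] at hm'
    exact hm'

end Typed
end Words

section NilProd

variable {R : Type*} [Ring R]

theorem submodule_pow_bot_mono {S : Submodule ℤ R} {a b : ℕ} (h : S ^ a = ⊥) (hab : a ≤ b) :
    S ^ b = ⊥ := by
  obtain ⟨c, rfl⟩ := Nat.exists_eq_add_of_le hab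
  rw [pow_add, h, Submodule.bot_mul]

theorem submodule_pow_le_pow {S T : Submodule ℤ R} (h : S ≤ T) (k : ℕ) : S ^ k ≤ T ^ k := by
  induction k with
  | zero => simp
  | succ k ih => rw [pow_succ, pow_succ]; exact mul_le_mul' ih h

theorem nilprod_one (S : Submodule ℤ R) (n q : ℕ) (hS : S ^ n = ⊥) (u : R) (hu : u ^ q = 0)
    (hc : ∀ s ∈ S, u * s - s * u ∈ S) : (S ⊔ Submodule.span ℤ {u}) ^ (n * q) = ⊥ := by
  set U : Submodule ℤ R := Submodule.span ℤ {u} with hU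
  let F : ℕ → Submodule ℤ R := fun i => S ^ i * ⊤
  have F0 : F 0 = ⊤ := by simp [F]
  have Fs : ∀ i, F (i + 1) = S * F i := fun i => by simp only [F]; rw [pow_succ', mul_assoc]
  have Fn : F n = ⊥ := by simp only [F]; rw [hS, Submodule.bot_mul]
  have US : U * S ≤ S * U ⊔ S := by
    rw [hU, Submodule.mul_le]
    intro m hm s hs
    obtain ⟨a, rfl⟩ := Submodule.mem_span_singleton.mp hm
    have e : (a • u) * s = s * (a • u) + a • (u * s - s * u) := by
      rw [smul_mul_assoc, mul_smul_comm, smul_sub]; abel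
    rw [e]
    exact Submodule.add_mem_sup (Submodule.mul_mem_mul hs hm) (S.smul_mem a (hc s hs))
  have UF : ∀ i, U * F i ≤ F i := by
    intro i
    induction i with
    | zero => rw [F0]; exact le_top
    | succ i ih =>
      rw [Fs, ← mul_assoc]
      refine (mul_le_mul' US (le_refl (F i))).trans ?_
      rw [Submodule.sup_mul, mul_assoc]
      exact sup_le (mul_le_mul' le_rfl ih) le_rfl
  have SF : ∀ i, S * F i ≤ F (i + 1) := fun i => (Fs i).ge
  have Fle : ∀ i, F (i + 1) ≤ F i := by
    intro i
    induction i with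
    | zero => rw [F0]; exact le_top
    | succ i ih => rw [Fs (i + 1)]; nth_rw 2 [Fs i]; exact mul_le_mul' le_rfl ih
  have TF : ∀ i, (S ⊔ U) * F i ≤ F i := fun i => by
    rw [Submodule.sup_mul]; exact sup_le ((SF i).trans (Fle i)) (UF i)
  have step : ∀ i k, (S ⊔ U) ^ k * F i ≤ U ^ k * F i ⊔ F (i + 1) := by
    intro i k
    induction k with
    | zero => simp
    | succ k ih =>
      rw [pow_succ', mul_assoc]
      refine (mul_le_mul' le_rfl ih).trans ?_
      rw [Submodule.mul_sup]
      refine sup_le ?_ ((TF _).trans le_sup_right)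
      rw [Submodule.sup_mul]
      refine sup_le ?_ ?_
      · refine le_trans ?_ ((SF i).trans le_sup_right)
        refine mul_le_mul' le_rfl ?_
        clear ih
        induction k with
        | zero => simp
        | succ k ih => rw [pow_succ', mul_assoc]; exact (mul_le_mul' le_rfl ih).trans (UF i)
      · rw [← mul_assoc, ← pow_succ']; exact le_sup_left
  have Uq : U ^ q = ⊥ := by
    rw [hU, Submodule.span_pow, Set.singleton_pow, hu]; simp
  have fin : ∀ i, (S ⊔ U) ^ (i * q) ≤ F i := by
    intro i
    induction i with
    | zero => rw [F0]; exact le_top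
    | succ i ih =>
      rw [add_mul, one_mul, add_comm, pow_add]
      refine (mul_le_mul' le_rfl ih).trans ((step i q).trans ?_)
      rw [Uq, Submodule.bot_mul, bot_sup_eq]
  rw [eq_bot_iff, ← Fn]
  exact fin n

theorem nilprod_list (S : Submodule ℤ R) (n q : ℕ) (hS : S ^ n = ⊥) (l : List R)
    (hu : ∀ u ∈ l, u ^ q = 0) (hc : ∀ u ∈ l, ∀ s ∈ S, u * s - s * u ∈ S)
    (hl : ∀ u ∈ l, ∀ v ∈ l, u * v - v * u ∈ S) :
    (S ⊔ Submodule.span ℤ {u | u ∈ l}) ^ (n * q ^ l.length) = ⊥ := by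
  induction l with
  | nil => simpa using hS
  | cons u l ih =>
    have ih := ih (fun v hv => hu v (List.mem_cons_of_mem _ hv))
      (fun v hv => hc v (List.mem_cons_of_mem _ hv))
      (fun v hv w hw => hl v (List.mem_cons_of_mem _ hv) w (List.mem_cons_of_mem _ hw))
    have := nilprod_one _ _ q ih u (hu u List.mem_cons_self) (by
      intro s hs
      obtain ⟨a, ha, b, hb, rfl⟩ := Submodule.mem_sup.mp hs
      have e : u * (a + b) - (a + b) * u = (u * a - a * u) + (u * b - b * u) := by noncomm_ring
      rw [e]
      refine Submodule.mem_sup_left (S.add_mem (hc u List.mem_cons_self a ha) ?_)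
      clear e hs
      induction hb using Submodule.span_induction with
      | mem x hx => exact hl u List.mem_cons_self x (List.mem_cons_of_mem _ hx)
      | zero => simp
      | add x y _ _ hx hy =>
        have e : u * (x + y) - (x + y) * u = (u * x - x * u) + (u * y - y * u) := by noncomm_ring
        rw [e]; exact S.add_mem hx hy
      | smul a x _ hx =>
        have e : u * (a • x) - (a • x) * u = a • (u * x - x * u) := by
          rw [smul_mul_assoc, mul_smul_comm, smul_sub]
        rw [e]; exact S.smul_mem _ hx)
    rw [List.length_cons, pow_succ, ← mul_assoc, ← this, sup_assoc, ← Submodule.span_union]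
    congr 3
    ext x
    simp

theorem nilprod_graded (M : ℕ → Submodule ℤ R) (q D n0 : ℕ) (hq : 0 < q) (h0 : 1 ≤ n0)
    (hM : ∀ i j, 1 ≤ i → 1 ≤ j → ∀ x ∈ M i, ∀ y ∈ M j, x * y - y * x ∈ M (i + j))
    (hz : ∀ i, n0 ≤ i → M i = ⊥)
    (hl : ∀ i, 1 ≤ i → i < n0 → ∃ l : List R, l.length ≤ D ∧ M i = Submodule.span ℤ {u | u ∈ l} ∧
      ∀ u ∈ l, u ^ q = 0) :
    M 1 ^ (q ^ (D * (n0 - 1))) = ⊥ := by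
  let N : ℕ → Submodule ℤ R := fun i => ⨆ j, ⨆ (_ : i ≤ j), M j
  have leN : ∀ i j, i ≤ j → M j ≤ N i := fun i j h => le_iSup₂_of_le j h le_rfl
  have Ns : ∀ i, N i ≤ N (i + 1) ⊔ M i := by
    intro i
    refine iSup₂_le fun j hj => ?_
    rcases hj.eq_or_lt with rfl | hj
    · exact le_sup_right
    · exact (leN (i + 1) j hj).trans le_sup_left
  have key : ∀ k, k + 1 ≤ n0 → N (n0 - k) ^ (q ^ (D * k)) = ⊥ := by
    intro k
    induction k with
    | zero =>
      intro _
      simp only [Nat.sub_zero, mul_zero, pow_zero, pow_one]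
      rw [eq_bot_iff]
      exact iSup₂_le fun j hj => (hz j hj).le
    | succ k ih =>
      intro hk
      have ih := ih (by omega)
      set i := n0 - (k + 1) with hi
      have hi1 : n0 - k = i + 1 := by omega
      rw [hi1] at ih
      obtain ⟨l, hlD, hMl, hlq⟩ := hl i (by omega) (by omega)
      have lM : ∀ u ∈ l, u ∈ M i := fun u hu => hMl ▸ Submodule.subset_span hu
      have t := nilprod_list (N (i + 1)) _ q ih l hlq (by
        intro u hu s hs
        induction hs using Submodule.iSup_induction' with
        | mem j x hx =>
          by_cases hj : i + 1 ≤ j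
          · simp only [hj, iSup_pos] at hx
            exact leN (i + 1) (i + j) (by omega) (hM i j (by omega) (by omega) u (lM u hu) x hx)
          · simp only [hj, iSup_false] at hx
            rw [Submodule.mem_bot] at hx
            simp [hx]
        | zero => simp
        | add x y _ _ hx hy =>
          have e : u * (x + y) - (x + y) * u = (u * x - x * u) + (u * y - y * u) := by noncomm_ring
          rw [e]; exact Submodule.add_mem _ hx hy)
        (fun u hu v hv => leN (i + 1) (i + i) (by omega)
          (hM i i (by omega) (by omega) u (lM u hu) v (lM v hv)))
      rw [← hMl] at t
      have t2 := submodule_pow_bot_mono t (b := q ^ (D * (k + 1))) (by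
        rw [mul_add, pow_add, mul_one]
        exact Nat.mul_le_mul_left _ (Nat.pow_le_pow_right hq hlD))
      rw [eq_bot_iff, ← t2]
      exact submodule_pow_le_pow (Ns i) _
  have := key (n0 - 1) (by omega)
  rw [show n0 - (n0 - 1) = 1 by omega] at this
  rw [eq_bot_iff, ← this]
  exact submodule_pow_le_pow (leN 1 1 le_rfl) _

end NilProd

section Graded

/-- The data extracted from the graded group ring of a `p`-group. -/
structure GrData (G : Type) [Group G] (p : ℕ) (R : Type) [Ring R] (D : ℕ → Subgroup G)
    (ψ : ℕ → G → R) : Prop where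
  D_one : D 1 = ⊤
  D_char : ∀ (σ : G ≃* G) (i : ℕ), ∀ g ∈ D i, σ g ∈ D i
  D_comm : ∀ i j : ℕ, 1 ≤ i → 1 ≤ j → ∀ g ∈ D i, ∀ h ∈ D j, (g * h * g⁻¹ * h⁻¹) ∈ D (i + j)
  add : ∀ i : ℕ, 1 ≤ i → ∀ g ∈ D i, ∀ h ∈ D i, ψ i (g * h) = ψ i g + ψ i h
  eq_zero : ∀ i : ℕ, 1 ≤ i → ∀ g ∈ D i, ψ i g = 0 ↔ g ∈ D (i + 1)
  bracket : ∀ i j : ℕ, 1 ≤ i → 1 ≤ j → ∀ g ∈ D i, ∀ h ∈ D j,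
    ψ (i + j) (g * h * g⁻¹ * h⁻¹) = ψ i g * ψ j h - ψ j h * ψ i g
  pow : ∀ i : ℕ, 1 ≤ i → ∀ g ∈ D i, ∀ e : ℕ, 0 < e → g ^ e = 1 → ψ i g ^ e = 0
  two : ∀ x : R, (2 : ℤ) • x = 0 → x = 0
  final : ∀ n : ℕ, 1 ≤ n → (Submodule.span ℤ (Set.range (ψ 1))) ^ n = ⊥ →
    ∀ s : ℕ, n ≤ p ^ s → ∀ g : G, g ^ (p ^ s) = 1

variable {Γ : Type} [Ring Γ]

/-- Polynomials whose coefficients lie in the powers of `I`. -/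
def reesRing (I : Submodule ℤ Γ) : Subring (Polynomial Γ) where
  carrier := {f | ∀ i, f.coeff i ∈ I ^ i}
  mul_mem' := by
    intro a b ha hb i
    rw [Polynomial.coeff_mul]
    refine Submodule.sum_mem _ fun x hx => ?_
    rw [← Finset.HasAntidiagonal.mem_antidiagonal.mp hx, pow_add]
    exact Submodule.mul_mem_mul (ha _) (hb _)
  one_mem' := by
    intro i
    rw [Polynomial.coeff_one]
    split_ifs with h
    · subst h; rw [pow_zero]; exact Submodule.one_le.mp le_rfl
    · exact Submodule.zero_mem _
  add_mem' := by
    intro a b ha hb i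
    rw [Polynomial.coeff_add]; exact Submodule.add_mem _ (ha i) (hb i)
  zero_mem' := by intro i; rw [Polynomial.coeff_zero]; exact Submodule.zero_mem _
  neg_mem' := by
    intro a ha i
    rw [Polynomial.coeff_neg]; exact Submodule.neg_mem _ (ha i)

/-- The ideal of elements whose coefficients lie one step deeper. -/
def reesIdeal (I : Submodule ℤ Γ) : Ideal (reesRing I) where
  carrier := {f | ∀ i, (f : Polynomial Γ).coeff i ∈ I ^ (i + 1)}
  add_mem' := by
    intro a b ha hb i
    rw [Subring.coe_add, Polynomial.coeff_add]; exact Submodule.add_mem _ (ha i) (hb i)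
  zero_mem' := by
    intro i; rw [Subring.coe_zero, Polynomial.coeff_zero]; exact Submodule.zero_mem _
  smul_mem' := by
    intro a b hb i
    rw [smul_eq_mul, Subring.coe_mul, Polynomial.coeff_mul]
    refine Submodule.sum_mem _ fun x hx => ?_
    rw [← Finset.HasAntidiagonal.mem_antidiagonal.mp hx, add_assoc, pow_add]
    exact Submodule.mul_mem_mul (a.2 _) (hb _)

instance reesIdeal_twoSided (I : Submodule ℤ Γ) : (reesIdeal I).IsTwoSided := ⟨by
    intro a b ha i
    rw [Subring.coe_mul, Polynomial.coeff_mul]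
    refine Submodule.sum_mem _ fun x hx => ?_
    rw [← Finset.HasAntidiagonal.mem_antidiagonal.mp hx, add_right_comm, pow_add]
    exact Submodule.mul_mem_mul (ha _) (b.2 _)⟩

theorem monomial_mem (I : Submodule ℤ Γ) {i : ℕ} {x : Γ} (hx : x ∈ I ^ i) :
    Polynomial.monomial i x ∈ reesRing I := by
  intro j
  rw [Polynomial.coeff_monomial]
  split_ifs with h
  · subst h; exact hx
  · exact Submodule.zero_mem _

open Classical in
/-- Leading form of degree `i`. -/
noncomputable def lead (I : Submodule ℤ Γ) (i : ℕ) (x : Γ) : reesRing I ⧸ reesIdeal I :=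
  if hx : x ∈ I ^ i then Ideal.Quotient.mk (reesIdeal I) ⟨Polynomial.monomial i x, monomial_mem I hx⟩
  else 0

theorem lead_add (I : Submodule ℤ Γ) {i : ℕ} {x y : Γ} (hx : x ∈ I ^ i) (hy : y ∈ I ^ i) :
    lead I i (x + y) = lead I i x + lead I i y := by
  rw [lead, lead, lead, dif_pos hx, dif_pos hy, dif_pos (Submodule.add_mem _ hx hy), ← map_add]
  congr 1
  ext1
  simp

theorem lead_mul (I : Submodule ℤ Γ) {i j : ℕ} {x y : Γ} (hx : x ∈ I ^ i) (hy : y ∈ I ^ j) :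
    lead I (i + j) (x * y) = lead I i x * lead I j y := by
  have hxy : x * y ∈ I ^ (i + j) := by rw [pow_add]; exact Submodule.mul_mem_mul hx hy
  rw [lead, lead, lead, dif_pos hx, dif_pos hy, dif_pos hxy, ← map_mul]
  congr 1
  ext1
  rw [Subring.coe_mul, Polynomial.monomial_mul_monomial]

theorem lead_eq_zero (I : Submodule ℤ Γ) {i : ℕ} {x : Γ} (hx : x ∈ I ^ i) :
    lead I i x = 0 ↔ x ∈ I ^ (i + 1) := by
  rw [lead, dif_pos hx, Ideal.Quotient.eq_zero_iff_mem]
  constructor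
  · intro h
    have := h i
    rwa [Polynomial.coeff_monomial_same] at this
  · intro h j
    change (Polynomial.monomial i x).coeff j ∈ _
    rw [Polynomial.coeff_monomial]
    split_ifs with hj
    · subst hj; exact h
    · exact Submodule.zero_mem _

theorem lead_congr (I : Submodule ℤ Γ) {i : ℕ} {x y : Γ} (hx : x ∈ I ^ i) (hy : y ∈ I ^ i)
    (h : x - y ∈ I ^ (i + 1)) : lead I i x = lead I i y := by
  have hd := Submodule.sub_mem _ hx hy
  have := lead_add I hd hy
  rw [(lead_eq_zero I hd).mpr h, sub_add_cancel, zero_add] at this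
  exact this

theorem lead_pow (I : Submodule ℤ Γ) {i : ℕ} {x : Γ} (hx : x ∈ I ^ i) (e : ℕ) :
    x ^ (e + 1) ∈ I ^ (i * (e + 1)) ∧ lead I i x ^ (e + 1) = lead I (i * (e + 1)) (x ^ (e + 1)) := by
  induction e with
  | zero => simpa using hx
  | succ e ih =>
    have h1 : x ^ (e + 1 + 1) ∈ I ^ (i * (e + 1 + 1)) := by
      rw [mul_add, pow_add, pow_succ x, mul_one]
      exact Submodule.mul_mem_mul ih.1 hx
    refine ⟨h1, ?_⟩
    rw [pow_succ, ih.2, mul_add i (e + 1) 1, mul_one, pow_succ x (e + 1), lead_mul I ih.1 hx]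

/-- Products of `n` elements of degree one. -/
theorem lead_prod_span (I : Submodule ℤ Γ) (S : Set Γ) (hS : I = Submodule.span ℤ S) (n : ℕ)
    (h : (Submodule.span ℤ (lead I 1 '' S)) ^ n = ⊥) : I ^ n ≤ I ^ (n + 1) := by
  have key : ∀ n, ∀ x ∈ I ^ n, lead I n x ∈ (Submodule.span ℤ (lead I 1 '' S)) ^ n := by
    intro n
    induction n with
    | zero =>
      intro x hx
      rw [pow_zero, Submodule.mem_one] at hx
      obtain ⟨k, rfl⟩ := hx
      rw [pow_zero, Submodule.mem_one]
      refine ⟨k, ?_⟩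
      have : (algebraMap ℤ Γ) k ∈ I ^ 0 := by
        rw [pow_zero]; exact Submodule.mem_one.mpr ⟨k, rfl⟩
      rw [lead, dif_pos this]
      have e : (⟨Polynomial.monomial 0 ((algebraMap ℤ Γ) k), monomial_mem I this⟩ : reesRing I)
          = (k : reesRing I) := by
        ext1; simp
      rw [e]; simp
    | succ n ih =>
      intro x hx
      rw [pow_succ] at hx
      refine Submodule.mul_induction_on (C := fun x => x ∈ I ^ (n + 1) ∧ lead I (n + 1) x ∈ _) hx
        ?_ ?_ |>.2
      · intro a ha b hb
        have hb1 : b ∈ I ^ 1 := by rwa [pow_one]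
        refine ⟨?_, ?_⟩
        · rw [pow_succ]; exact Submodule.mul_mem_mul ha hb
        · rw [lead_mul I ha hb1, pow_succ]
          refine Submodule.mul_mem_mul (ih a ha) ?_
          rw [hS] at hb
          clear hb1
          refine (Submodule.span_induction (p := fun b _ => b ∈ I ^ 1 ∧ lead I 1 b ∈
            Submodule.span ℤ (lead I 1 '' S)) ?_ ?_ ?_ ?_ hb).2
          · intro b hb
            refine ⟨?_, Submodule.subset_span ⟨b, hb, rfl⟩⟩
            rw [pow_one, hS]; exact Submodule.subset_span hb
          · refine ⟨Submodule.zero_mem _, ?_⟩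
            rw [(lead_eq_zero I (Submodule.zero_mem _)).mpr (Submodule.zero_mem _)]
            exact Submodule.zero_mem _
          · rintro x y _ _ ⟨hx, hx'⟩ ⟨hy, hy'⟩
            refine ⟨Submodule.add_mem _ hx hy, ?_⟩
            rw [lead_add I hx hy]; exact Submodule.add_mem _ hx' hy'
          · rintro k x _ ⟨hx, hx'⟩
            refine ⟨Submodule.smul_mem _ k hx, ?_⟩
            have : lead I 1 (k • x) = lead I 1 ((k : Γ) * x) := by rw [zsmul_eq_mul]
            let f : (I ^ 1 : Submodule ℤ Γ) →+ (reesRing I ⧸ reesIdeal I) :=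
              AddMonoidHom.mk' (fun x => lead I 1 x.1) (fun x y => lead_add I x.2 y.2)
            have := map_zsmul f k ⟨x, hx⟩
            change lead I 1 (k • x) = k • lead I 1 x at this
            rw [this]
            exact Submodule.smul_mem _ k hx'
      · rintro x y ⟨hx, hx'⟩ ⟨hy, hy'⟩
        refine ⟨Submodule.add_mem _ hx hy, ?_⟩
        rw [lead_add I hx hy]; exact Submodule.add_mem _ hx' hy'
  intro x hx
  have := key n x hx
  rw [h, Submodule.mem_bot, lead_eq_zero I hx] at this
  exact this

end Graded

section GroupRing

variable (G : Type) [Group G] (p : ℕ)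

/-- The augmentation ideal, as a subgroup. -/
noncomputable def augI : Submodule ℤ (MonoidAlgebra (ZMod p) G) :=
  Submodule.span ℤ (Set.range fun g : G => MonoidAlgebra.of (ZMod p) G g - 1)

variable {G p}

theorem of_sub_one_mem (g : G) : MonoidAlgebra.of (ZMod p) G g - 1 ∈ augI G p :=
  Submodule.subset_span ⟨g, rfl⟩

theorem augI_mul_le : augI G p * augI G p ≤ augI G p := by
  rw [augI, Submodule.span_mul_span, Submodule.span_le]
  rintro _ ⟨_, ⟨g, rfl⟩, _, ⟨h, rfl⟩, rfl⟩
  have e : (MonoidAlgebra.of (ZMod p) G g - 1) * (MonoidAlgebra.of (ZMod p) G h - 1)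
      = (MonoidAlgebra.of (ZMod p) G (g * h) - 1) - (MonoidAlgebra.of (ZMod p) G g - 1)
        - (MonoidAlgebra.of (ZMod p) G h - 1) := by
    rw [map_mul]; noncomm_ring
  change (MonoidAlgebra.of (ZMod p) G g - 1) * (MonoidAlgebra.of (ZMod p) G h - 1) ∈ _
  rw [e]
  exact Submodule.sub_mem _ (Submodule.sub_mem _ (of_sub_one_mem _) (of_sub_one_mem _))
    (of_sub_one_mem _)

theorem augI_pow_succ_le {i : ℕ} (hi : 1 ≤ i) : augI G p ^ (i + 1) ≤ augI G p ^ i := by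
  obtain ⟨k, rfl⟩ := Nat.exists_eq_add_of_le' hi
  rw [pow_succ, pow_succ, mul_assoc]
  exact mul_le_mul' le_rfl augI_mul_le

theorem augI_pow_le {i j : ℕ} (hi : 1 ≤ i) (hij : i ≤ j) : augI G p ^ j ≤ augI G p ^ i := by
  induction j, hij using Nat.le_induction with
  | base => exact le_rfl
  | succ j hj ih => exact (augI_pow_succ_le (hi.trans hj)).trans ih

theorem augI_mul_sub {i : ℕ} {x : MonoidAlgebra (ZMod p) G} (hx : x ∈ augI G p ^ i) (g : G) :
    x * MonoidAlgebra.of (ZMod p) G g - x ∈ augI G p ^ (i + 1) := by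
  have e : x * MonoidAlgebra.of (ZMod p) G g - x = x * (MonoidAlgebra.of (ZMod p) G g - 1) := by
    noncomm_ring
  rw [e, pow_succ]
  exact Submodule.mul_mem_mul hx (of_sub_one_mem g)

theorem augI_mul_of {i : ℕ} (hi : 1 ≤ i) {x : MonoidAlgebra (ZMod p) G} (hx : x ∈ augI G p ^ i)
    (g : G) : x * MonoidAlgebra.of (ZMod p) G g ∈ augI G p ^ i := by
  rw [← sub_add_cancel (x * MonoidAlgebra.of (ZMod p) G g) x]
  exact Submodule.add_mem _ (augI_pow_succ_le hi (augI_mul_sub hx g)) hx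

theorem of_mul_sub (g h : G) : MonoidAlgebra.of (ZMod p) G (g * h) - 1
    = (MonoidAlgebra.of (ZMod p) G g - 1) + (MonoidAlgebra.of (ZMod p) G h - 1)
      + (MonoidAlgebra.of (ZMod p) G g - 1) * (MonoidAlgebra.of (ZMod p) G h - 1) := by
  rw [map_mul]; noncomm_ring

variable (G p) in
/-- Dimension subgroups. -/
noncomputable def dimD (i : ℕ) : Subgroup G where
  carrier := {g | i = 0 ∨ MonoidAlgebra.of (ZMod p) G g - 1 ∈ augI G p ^ i}
  one_mem' := by right; rw [map_one, sub_self]; exact Submodule.zero_mem _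
  mul_mem' := by
    rintro g h hg hh
    rcases Nat.eq_zero_or_pos i with hi | hi
    · exact Or.inl hi
    · right
      have hg := hg.resolve_left (by omega)
      have hh := hh.resolve_left (by omega)
      rw [of_mul_sub]
      refine Submodule.add_mem _ (Submodule.add_mem _ hg hh) (augI_pow_le hi (show i ≤ i + i by omega) ?_)
      rw [pow_add]; exact Submodule.mul_mem_mul hg hh
  inv_mem' := by
    rintro g hg
    rcases Nat.eq_zero_or_pos i with hi | hi
    · exact Or.inl hi
    · right
      have hg := hg.resolve_left (by omega)
      have e : MonoidAlgebra.of (ZMod p) G g⁻¹ - 1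
          = -((MonoidAlgebra.of (ZMod p) G g - 1) * MonoidAlgebra.of (ZMod p) G g⁻¹) := by
        rw [sub_mul, ← map_mul, mul_inv_cancel, map_one, one_mul, neg_sub]
      rw [e]
      exact Submodule.neg_mem _ (augI_mul_of hi hg _)

theorem mem_dimD {i : ℕ} (hi : 1 ≤ i) {g : G} :
    g ∈ dimD G p i ↔ MonoidAlgebra.of (ZMod p) G g - 1 ∈ augI G p ^ i :=
  ⟨fun h => h.resolve_left (by omega), Or.inr⟩

theorem of_comm_sub (g h : G) : MonoidAlgebra.of (ZMod p) G (g * h * g⁻¹ * h⁻¹) - 1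
    = ((MonoidAlgebra.of (ZMod p) G g - 1) * (MonoidAlgebra.of (ZMod p) G h - 1)
      - (MonoidAlgebra.of (ZMod p) G h - 1) * (MonoidAlgebra.of (ZMod p) G g - 1))
      * MonoidAlgebra.of (ZMod p) G (g⁻¹ * h⁻¹) := by
  have e : (MonoidAlgebra.of (ZMod p) G g - 1) * (MonoidAlgebra.of (ZMod p) G h - 1)
      - (MonoidAlgebra.of (ZMod p) G h - 1) * (MonoidAlgebra.of (ZMod p) G g - 1)
      = MonoidAlgebra.of (ZMod p) G (g * h) - MonoidAlgebra.of (ZMod p) G (h * g) := by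
    rw [map_mul, map_mul]; noncomm_ring
  rw [e, sub_mul, ← map_mul, ← map_mul, ← mul_assoc]
  congr 1
  rw [show h * g * (g⁻¹ * h⁻¹) = 1 by group, map_one]

theorem dimD_char (σ : G ≃* G) (i : ℕ) (g : G) (hg : g ∈ dimD G p i) : σ g ∈ dimD G p i := by
  rcases Nat.eq_zero_or_pos i with hi | hi
  · exact Or.inl hi
  rw [mem_dimD hi] at hg ⊢
  let f : MonoidAlgebra (ZMod p) G →ₐ[ℤ] MonoidAlgebra (ZMod p) G :=
    (MonoidAlgebra.mapDomainRingHom (ZMod p) (σ : G →* G)).toIntAlgHom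
  have fof : ∀ g : G, f (MonoidAlgebra.of (ZMod p) G g - 1) = MonoidAlgebra.of (ZMod p) G (σ g) - 1 := by
    intro g
    rw [map_sub, map_one]
    congr 1
    change MonoidAlgebra.mapDomainRingHom (ZMod p) (σ : G →* G) (MonoidAlgebra.of (ZMod p) G g) = _
    simp
  have hI : (augI G p).map f.toLinearMap ≤ augI G p := by
    rw [augI, Submodule.map_span, Submodule.span_le]
    rintro _ ⟨_, ⟨g, rfl⟩, rfl⟩
    change f (MonoidAlgebra.of (ZMod p) G g - 1) ∈ _
    rw [fof]; exact of_sub_one_mem _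
  have : ∀ x ∈ augI G p ^ i, f x ∈ augI G p ^ i := by
    intro x hx
    have h1 : f x ∈ (augI G p ^ i).map f.toLinearMap := ⟨x, hx, rfl⟩
    rw [Submodule.map_pow] at h1
    exact submodule_pow_le_pow hI i h1
  rw [← fof]
  exact this _ hg

theorem augI_nilp [Finite G] [hp : Fact p.Prime] (hG : IsPGroup p G) {n : ℕ} (hn : 1 ≤ n)
    (h : augI G p ^ n ≤ augI G p ^ (n + 1)) : augI G p ^ n = ⊥ := by
  classical
  let T : AddSubgroup (MonoidAlgebra (ZMod p) G) :=
    { carrier := {x | ∀ y ∈ augI G p ^ n, y * x = 0}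
      add_mem' := fun {a b} ha hb y hy => by rw [mul_add, ha y hy, hb y hy, add_zero]
      zero_mem' := fun y hy => mul_zero y
      neg_mem' := fun {a} ha y hy => by rw [mul_neg, ha y hy, neg_zero] }
  have hT : ∀ g : G, T ≤ T.comap (AddMonoidHom.mulLeft (MonoidAlgebra.of (ZMod p) G g)) := by
    intro g x hx y hy
    change y * (_ * x) = 0
    rw [← mul_assoc]
    exact hx _ (augI_mul_of hn hy g)
  let _act : MulAction G (MonoidAlgebra (ZMod p) G ⧸ T) :=
    { smul := fun g => QuotientAddGroup.map T T _ (hT g)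
      one_smul := by
        intro q
        induction q using QuotientAddGroup.induction_on with
        | H x =>
          change QuotientAddGroup.map T T _ (hT 1) _ = _
          rw [QuotientAddGroup.map_mk, AddMonoidHom.coe_mulLeft, map_one, one_mul]
      mul_smul := by
        intro a b q
        induction q using QuotientAddGroup.induction_on with
        | H x =>
          change QuotientAddGroup.map T T _ (hT (a * b)) _ =
            QuotientAddGroup.map T T _ (hT a) (QuotientAddGroup.map T T _ (hT b) _)
          rw [QuotientAddGroup.map_mk, QuotientAddGroup.map_mk, QuotientAddGroup.map_mk]
          simp only [AddMonoidHom.coe_mulLeft, map_mul, mul_assoc] }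
  have smul_mk : ∀ (g : G) (x : MonoidAlgebra (ZMod p) G),
      g • (x : MonoidAlgebra (ZMod p) G ⧸ T) = ((MonoidAlgebra.of (ZMod p) G g * x :
        MonoidAlgebra (ZMod p) G) : MonoidAlgebra (ZMod p) G ⧸ T) := fun g x => rfl
  have fin : Finite (MonoidAlgebra (ZMod p) G) := by
    have : NeZero p := ⟨hp.out.ne_zero⟩
    exact Module.finite_of_finite (ZMod p)
  have fix : ∀ q ∈ MulAction.fixedPoints G (MonoidAlgebra (ZMod p) G ⧸ T), q = 0 := by
    intro q
    induction q using QuotientAddGroup.induction_on with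
    | H x =>
      intro hx
      rw [QuotientAddGroup.eq_zero_iff]
      intro y hy
      have hy' := h hy
      rw [pow_succ] at hy'
      have hI : ∀ z ∈ augI G p, z * x ∈ T := by
        intro z hz
        rw [augI] at hz
        induction hz using Submodule.span_induction with
        | mem z hz =>
          obtain ⟨g, rfl⟩ := hz
          have := hx g
          rw [smul_mk, QuotientAddGroup.eq] at this
          have := T.neg_mem this
          convert this using 1
          change (MonoidAlgebra.of (ZMod p) G g - 1) * x = _
          noncomm_ring
        | zero => rw [zero_mul]; exact T.zero_mem
        | add a b _ _ ha hb => rw [add_mul]; exact T.add_mem ha hb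
        | smul k a _ ha => rw [smul_mul_assoc]; exact T.zsmul_mem ha k
      refine Submodule.mul_induction_on hy' ?_ ?_
      · intro a ha b hb
        rw [mul_assoc]
        exact hI b hb a ha
      · intro a b ha hb
        rw [add_mul, ha, hb, add_zero]
  have cfix : Nat.card (MulAction.fixedPoints G (MonoidAlgebra (ZMod p) G ⧸ T)) = 1 := by
    rw [Nat.card_eq_one_iff_unique]
    refine ⟨⟨fun a b => Subtype.ext ((fix a a.2).trans (fix b b.2).symm)⟩, ⟨⟨0, fun g => ?_⟩⟩⟩
    exact (smul_mk g 0).trans (by rw [mul_zero]; rfl)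
  have hmod := hG.card_modEq_card_fixedPoints (MonoidAlgebra (ZMod p) G ⧸ T)
  rw [cfix] at hmod
  have hdvd : Nat.card (MonoidAlgebra (ZMod p) G ⧸ T) = 1 := by
    by_contra hne
    obtain ⟨q, hq, hqd⟩ := Nat.exists_prime_and_dvd hne
    have : Fact q.Prime := ⟨hq⟩
    obtain ⟨x, hx⟩ := exists_prime_addOrderOf_dvd_card' q hqd
    have hpx : p • x = 0 := by
      induction x using QuotientAddGroup.induction_on with
      | H x =>
        rw [← QuotientAddGroup.mk_nsmul]
        have : p • x = 0 := by
          rw [nsmul_eq_mul]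
          have : (p : MonoidAlgebra (ZMod p) G) = 0 := by
            rw [← map_natCast (algebraMap (ZMod p) (MonoidAlgebra (ZMod p) G))]; simp
          rw [this, zero_mul]
        rw [this]; rfl
    have := addOrderOf_dvd_of_nsmul_eq_zero hpx
    rw [hx, Nat.prime_dvd_prime_iff_eq hq hp.out] at this
    subst this
    have h0 := (Nat.modEq_zero_iff_dvd.mpr hqd).symm.trans hmod
    exact hq.one_lt.ne' (Nat.dvd_one.mp ((Nat.modEq_zero_iff_dvd).mp h0.symm))
  have hT1 : (1 : MonoidAlgebra (ZMod p) G) ∈ T := by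
    rw [← QuotientAddGroup.eq_zero_iff]
    have := (Nat.card_eq_one_iff_unique.mp hdvd).1
    exact Subsingleton.elim _ _
  rw [eq_bot_iff]
  intro y hy
  have := hT1 y hy
  rwa [mul_one] at this

theorem of_sub_pow [hp : Fact p.Prime] (g : G) (s : ℕ) :
    (MonoidAlgebra.of (ZMod p) G g - 1) ^ (p ^ s) = MonoidAlgebra.of (ZMod p) G (g ^ (p ^ s)) - 1 := by
  have : CharP (MonoidAlgebra (ZMod p) G) p :=
    charP_of_injective_ringHom (algebraMap (ZMod p) (MonoidAlgebra (ZMod p) G)).injective p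
  rw [sub_pow_char_pow_of_commute _ _ (Commute.one_right _), one_pow, map_pow]

theorem exists_grData [Finite G] [hp : Fact p.Prime] (hp2 : p ≠ 2) (hG : IsPGroup p G) :
    ∃ (R : Type) (_ : Ring R) (D : ℕ → Subgroup G) (ψ : ℕ → G → R), GrData G p R D ψ := by
  refine ⟨reesRing (augI G p) ⧸ reesIdeal (augI G p), inferInstance, dimD G p,
    fun i g => lead (augI G p) i (MonoidAlgebra.of (ZMod p) G g - 1), ?_⟩
  refine ⟨?_, dimD_char, ?_, ?_, ?_, ?_, ?_, ?_, ?_⟩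
  · rw [eq_top_iff]
    intro g _
    rw [mem_dimD le_rfl, pow_one]; exact of_sub_one_mem g
  · intro i j hi hj g hg h hh
    rw [mem_dimD hi] at hg
    rw [mem_dimD hj] at hh
    rw [mem_dimD (by omega), of_comm_sub]
    refine augI_mul_of (by omega) (Submodule.sub_mem _ ?_ ?_) _
    · rw [pow_add]; exact Submodule.mul_mem_mul hg hh
    · rw [add_comm, pow_add]; exact Submodule.mul_mem_mul hh hg
  · intro i hi g hg h hh
    rw [mem_dimD hi] at hg hh
    rw [← lead_add _ hg hh]
    have hgh : MonoidAlgebra.of (ZMod p) G (g * h) - 1 ∈ augI G p ^ i :=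
      (mem_dimD hi).mp ((dimD G p i).mul_mem ((mem_dimD hi).mpr hg) ((mem_dimD hi).mpr hh))
    refine lead_congr _ hgh (Submodule.add_mem _ hg hh) ?_
    rw [of_mul_sub, add_sub_cancel_left]
    refine augI_pow_le (by omega) (show i + 1 ≤ i + i by omega) ?_
    rw [pow_add]; exact Submodule.mul_mem_mul hg hh
  · intro i hi g hg
    rw [mem_dimD hi] at hg
    rw [mem_dimD (by omega)]
    exact lead_eq_zero _ hg
  · intro i j hi hj g hg h hh
    rw [mem_dimD hi] at hg
    rw [mem_dimD hj] at hh
    have h1 : (MonoidAlgebra.of (ZMod p) G g - 1) * (MonoidAlgebra.of (ZMod p) G h - 1)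
      ∈ augI G p ^ (i + j) := by rw [pow_add]; exact Submodule.mul_mem_mul hg hh
    have h2 : (MonoidAlgebra.of (ZMod p) G h - 1) * (MonoidAlgebra.of (ZMod p) G g - 1)
      ∈ augI G p ^ (i + j) := by rw [add_comm, pow_add]; exact Submodule.mul_mem_mul hh hg
    have e2 : lead (augI G p) (i + j) ((MonoidAlgebra.of (ZMod p) G h - 1) *
        (MonoidAlgebra.of (ZMod p) G g - 1)) = lead (augI G p) j (MonoidAlgebra.of (ZMod p) G h - 1) *
        lead (augI G p) i (MonoidAlgebra.of (ZMod p) G g - 1) := by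
      rw [add_comm, lead_mul _ hh hg]
    have h3 := Submodule.sub_mem _ h1 h2
    rw [eq_sub_iff_add_eq, ← e2, ← lead_mul _ hg hh]
    have h4 := lead_add (augI G p) h3 h2
    rw [sub_add_cancel] at h4
    rw [h4]
    congr 1
    refine lead_congr _ ?_ h3 ?_
    · rw [of_comm_sub]; exact augI_mul_of (by omega) h3 _
    · rw [of_comm_sub]; exact augI_mul_sub h3 _
  · intro i hi g hg e he hge
    rw [mem_dimD hi] at hg
    obtain ⟨k, rfl⟩ := Nat.exists_eq_add_of_le' (show 1 ≤ e from he)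
    rw [(lead_pow _ hg k).2]
    have : (MonoidAlgebra.of (ZMod p) G g - 1) ^ (k + 1) = 0 := by
      obtain ⟨s, hs⟩ := (IsPGroup.iff_orderOf.mp hG) g
      have hdvd : p ^ s ∣ k + 1 := hs ▸ orderOf_dvd_of_pow_eq_one hge
      obtain ⟨c, hc⟩ := hdvd
      rw [hc, pow_mul, of_sub_pow, ← hs, pow_orderOf_eq_one, map_one, sub_self, zero_pow]
      rintro rfl
      omega
    rw [this, lead_eq_zero _ (Submodule.zero_mem _)]
    exact Submodule.zero_mem _
  · intro x hx
    have hpx : (p : ℤ) • x = 0 := by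
      have h0 : (p : MonoidAlgebra (ZMod p) G) = 0 := by
        rw [← map_natCast (algebraMap (ZMod p) (MonoidAlgebra (ZMod p) G))]; simp
      have h1 : (p : reesRing (augI G p)) = 0 := by
        ext1
        rw [Subring.coe_natCast, ← map_natCast Polynomial.C, h0, map_zero, Subring.coe_zero]
      have h2 : (p : reesRing (augI G p) ⧸ reesIdeal (augI G p)) = 0 := by
        rw [← map_natCast (Ideal.Quotient.mk (reesIdeal (augI G p))), h1, map_zero]
      rw [zsmul_eq_mul, Int.cast_natCast, h2, zero_mul]
    have hcop : IsCoprime (2 : ℤ) (p : ℤ) := by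
      have := (Nat.coprime_primes Nat.prime_two hp.out).mpr (Ne.symm hp2)
      exact_mod_cast Nat.isCoprime_iff_coprime.mpr this
    obtain ⟨a, b, hab⟩ := hcop
    have : (a * 2 + b * p) • x = 0 := by
      rw [add_smul, mul_smul, mul_smul, hx, hpx, smul_zero, smul_zero, add_zero]
    rwa [hab, one_smul] at this
  · intro n hn h s hs g
    have h1 := lead_prod_span (augI G p) _ rfl n (by
      rw [← h]
      congr 2
      ext x
      simp only [Set.mem_image, Set.mem_range, exists_exists_eq_and])
    have h2 := augI_nilp hG hn h1
    have h3 : (MonoidAlgebra.of (ZMod p) G g - 1) ^ n = 0 := by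
      have : (MonoidAlgebra.of (ZMod p) G g - 1) ^ n ∈ augI G p ^ n :=
        Submodule.pow_mem_pow _ (of_sub_one_mem g) n
      rwa [h2] at this
    have h4 := pow_eq_zero_of_le hs h3
    rw [of_sub_pow, sub_eq_zero, ← map_one (MonoidAlgebra.of (ZMod p) G)] at h4
    exact MonoidAlgebra.of_injective h4

end GroupRing

section Action

/-- The relations of the action which are used. -/
structure Act (G : Type) [Group G] (e : ℕ) (d T : Fin 3 → MulAut G) : Prop where
  odd : Odd (Nat.card G)
  dd : ∀ s x, d s (d s x) = x
  dt : ∀ s t x, s ≠ t → d s (d t x) = d (-(s + t)) x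
  TT : ∀ u x, T u (T u x) = x
  Td : ∀ u s x, T u (d s x) = d (-(u + s)) (T u x)
  braid : ∀ s x, T s (T (s + 1) (T s x)) = T (s + 2) (d (s + 2) x)
  fixV : ∀ x, (∀ s, d s x = x) → x = 1
  eT : ∀ u x, T u x = x → x ^ e = 1
  eTd : ∀ u x, T u (d u x) = x → x ^ e = 1

variable {G : Type} [Group G]

theorem odd_sqrt (hodd : Odd (Nat.card G)) :
    ∃ k : ℕ, ∀ g : G, g ^ k * g ^ k = g := by
  obtain ⟨m, hm⟩ := hodd
  refine ⟨m + 1, fun g => ?_⟩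
  rw [← pow_add, show m + 1 + (m + 1) = Nat.card G + 1 by omega, pow_succ, pow_card_eq_one', one_mul]

theorem lift_fixed (hodd : Odd (Nat.card G)) (θ : MulAut G) (hθ : ∀ x, θ (θ x) = x) (g : G)
    (K : Subgroup G) (hK : θ g * g⁻¹ ∈ K) : ∃ r ∈ K, θ (r * g) = r * g ∧ θ r = r⁻¹ := by
  obtain ⟨k, hk⟩ := odd_sqrt (G := G) hodd
  set w := θ g * g⁻¹ with hw
  have hθw : θ w = w⁻¹ := by rw [hw, map_mul, map_inv, hθ, mul_inv_rev, inv_inv]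
  have hr : θ (w ^ k) = (w ^ k)⁻¹ := by rw [map_pow, hθw, inv_pow]
  refine ⟨w ^ k, K.pow_mem hK k, ?_, hr⟩
  have e : θ g = w ^ k * w ^ k * g := by rw [hk, hw]; group
  rw [map_mul, hr, e]; group

namespace Act

variable {e : ℕ} {d T : Fin 3 → MulAut G}

theorem inv (h : Act G e d T) {s t : Fin 3} (hst : s ≠ t) {x : G} (hx : d s x = x) :
    d t x = x⁻¹ := by
  have hcm : ∀ y, d s (d t y) = d t (d s y) := fun y => by
    rw [h.dt s t y hst, h.dt t s y hst.symm, add_comm]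
  let K : Subgroup G := (MulEquiv.toMonoidHom (d s)).eqLocus (MonoidHom.id G)
  have memK : ∀ y, y ∈ K ↔ d s y = y := fun y => Iff.rfl
  obtain ⟨r, hrK, hfix, hr⟩ := lift_fixed h.odd (d t) (h.dd t) x K (by
    rw [memK, map_mul, map_inv, hcm, hx])
  rw [memK] at hrK
  have h1 : r * x = 1 := by
    apply h.fixV
    have hs : d s (r * x) = r * x := by rw [map_mul, hrK, hx]
    intro u
    by_cases h1 : u = s
    · rw [h1]; exact hs
    by_cases h2 : u = t
    · rw [h2]; exact hfix
    · rw [f3f u s t h1 h2 hst, ← h.dt s t _ hst, hfix, hs]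
  have hx' : x = r⁻¹ := (inv_eq_of_mul_eq_one_right h1).symm
  rw [hx', map_inv, hr]

theorem commute (h : Act G e d T) {s : Fin 3} {x y : G} (hx : d s x = x) (hy : d s y = y) :
    x * y = y * x := by
  have hne : s ≠ s + 1 := f3g s
  have h1 := h.inv hne hx
  have h2 := h.inv hne hy
  have h3 := h.inv hne (x := x * y) (by rw [map_mul, hx, hy])
  rw [map_mul, h1, h2, ← mul_inv_rev, inv_inj] at h3
  exact h3.symm

theorem dT (h : Act G e d T) {u s r : Fin 3} (hr : r = -(u + s)) {x : G} (hx : d s x = x) :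
    d r (T u x) = T u x := by
  rw [hr, ← h.Td, hx]

end Act

end Action

section LowerCentral

variable {G : Type} [Group G]

variable (G) in
/-- The lower central series, starting at `⊤`. -/
def gm : ℕ → Subgroup G
  | 0 => ⊤
  | k + 1 => Subgroup.closure {v | ∃ g : G, ∃ h ∈ gm k, v = g * h * g⁻¹ * h⁻¹}

theorem gm_char (σ : MulAut G) (k : ℕ) : ∀ g ∈ gm G k, σ g ∈ gm G k := by
  induction k with
  | zero => intro g _; exact Subgroup.mem_top _
  | succ k ih =>
    intro g hg
    rw [gm] at hg ⊢
    induction hg using Subgroup.closure_induction with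
    | mem v hv =>
      obtain ⟨g, h, hh, rfl⟩ := hv
      exact Subgroup.subset_closure ⟨σ g, σ h, ih h hh, by simp⟩
    | one => rw [map_one]; exact Subgroup.one_mem _
    | mul a b _ _ ha hb => rw [map_mul]; exact Subgroup.mul_mem _ ha hb
    | inv a _ ha => rw [map_inv]; exact Subgroup.inv_mem _ ha

end LowerCentral

section PGroup

attribute [local instance] LieRing.ofAssociativeRing

namespace GrData

variable {G : Type} [Group G] {p : ℕ} {R : Type} [Ring R] {D : ℕ → Subgroup G} {ψ : ℕ → G → R}

theorem one (h : GrData G p R D ψ) {i : ℕ} (hi : 1 ≤ i) : ψ i 1 = 0 :=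
  (h.eq_zero i hi 1 (D i).one_mem).2 (D (i + 1)).one_mem

theorem inv (h : GrData G p R D ψ) {i : ℕ} (hi : 1 ≤ i) {g : G} (hg : g ∈ D i) :
    ψ i g⁻¹ = -ψ i g := by
  have h1 := h.add i hi g hg g⁻¹ ((D i).inv_mem hg)
  rw [mul_inv_cancel, h.one hi] at h1
  exact (neg_eq_of_add_eq_zero_right h1.symm).symm

theorem divmem (h : GrData G p R D ψ) {i : ℕ} (hi : 1 ≤ i) {g g' : G} (hg : g ∈ D i)
    (hg' : g' ∈ D i) : ψ i g = ψ i g' ↔ g * g'⁻¹ ∈ D (i + 1) := by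
  rw [← h.eq_zero i hi _ ((D i).mul_mem hg ((D i).inv_mem hg')),
    h.add i hi g hg _ ((D i).inv_mem hg'), h.inv hi hg', ← sub_eq_add_neg, sub_eq_zero]

theorem congrσ (h : GrData G p R D ψ) {i : ℕ} (hi : 1 ≤ i) {g g' : G} (hg : g ∈ D i)
    (hg' : g' ∈ D i) (σ : MulAut G) (hgg : ψ i g = ψ i g') : ψ i (σ g) = ψ i (σ g') := by
  rw [h.divmem hi (h.D_char σ i g hg) (h.D_char σ i g' hg'), ← map_inv, ← map_mul]
  exact h.D_char σ _ _ ((h.divmem hi hg hg').1 hgg)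

theorem liftψ (h : GrData G p R D ψ) (hodd : Odd (Nat.card G)) (θ : MulAut G)
    (hθ : ∀ x, θ (θ x) = x) {i : ℕ} (hi : 1 ≤ i) (H : Subgroup G) (hH : ∀ g ∈ H, g ∈ D i)
    (hθH : ∀ g ∈ H, θ g ∈ H) {g : G} (hg : g ∈ H) (heq : ψ i (θ g) = ψ i g) :
    ∃ g' ∈ H, θ g' = g' ∧ ψ i g' = ψ i g := by
  have h1 := (h.divmem hi (hH _ (hθH _ hg)) (hH _ hg)).1 heq
  obtain ⟨r, hr, hf, -⟩ := lift_fixed hodd θ hθ g (H ⊓ D (i + 1))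
    ⟨H.mul_mem (hθH _ hg) (H.inv_mem hg), h1⟩
  refine ⟨r * g, H.mul_mem hr.1 hg, hf, ?_⟩
  rw [h.add i hi r (hH _ hr.1) g (hH _ hg), (h.eq_zero i hi r (hH _ hr.1)).2 hr.2, zero_add]

theorem gm_le (h : GrData G p R D ψ) (k : ℕ) : ∀ g ∈ gm G k, g ∈ D (k + 1) := by
  induction k with
  | zero => intro g _; rw [h.D_one]; exact Subgroup.mem_top _
  | succ k ih =>
    intro g hg
    rw [gm] at hg
    refine (Subgroup.closure_le _).2 ?_ hg
    rintro v ⟨g, x, hx, rfl⟩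
    have := h.D_comm 1 (k + 1) le_rfl (by omega) g (by rw [h.D_one]; trivial) x (ih x hx)
    rw [show k + 1 + 1 = 1 + (k + 1) by omega]
    exact this

variable {e : ℕ} {d T : Fin 3 → MulAut G}

theorem bracket_lift (h : GrData G p R D ψ) (hA : Act G e d T) {i j : ℕ} (hi : 1 ≤ i) (hj : 1 ≤ j)
    {x y : G} (hx : x ∈ D i) (hy : y ∈ D j) {s t : Fin 3} (hst : s ≠ t) (hsx : d s x = x)
    (hty : d t y = y) (H : Subgroup G) (hH : ∀ g ∈ H, g ∈ D (i + j))
    (hθH : ∀ (σ : MulAut G), ∀ g ∈ H, σ g ∈ H) (hm : x * y * x⁻¹ * y⁻¹ ∈ H) :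
    ∃ m ∈ H, d (-(s + t)) m = m ∧ ψ (i + j) m = ψ i x * ψ j y - ψ j y * ψ i x := by
  have e1 : s ≠ -(s + t) := by
    clear * - hst
    decide +revert
  have e2 : t ≠ -(s + t) := by
    clear * - hst
    decide +revert
  rw [← h.bracket i j hi hj x hx y hy]
  refine h.liftψ hA.odd _ (hA.dd _) (by omega) H hH (hθH _) hm ?_
  rw [map_mul, map_mul, map_mul, map_inv, map_inv, hA.inv e1 hsx, hA.inv e2 hty,
    h.bracket i j hi hj _ ((D i).inv_mem hx) _ ((D j).inv_mem hy),
    h.bracket i j hi hj x hx y hy, h.inv hi hx, h.inv hj hy]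
  noncomm_ring

/-- The three pieces. -/
def Ls (D : ℕ → Subgroup G) (ψ : ℕ → G → R) (d : Fin 3 → MulAut G) (s : Fin 3) : AddSubgroup R :=
  AddSubgroup.closure {v | ∃ i, 1 ≤ i ∧ ∃ x ∈ D i, d s x = x ∧ v = ψ i x}

theorem closure_lie {R : Type} [LieRing R] (S S' : Set R) (M : AddSubgroup R) (hM : ∀ x ∈ S, ∀ y ∈ S', ⁅x, y⁆ ∈ M) :
    ∀ x ∈ AddSubgroup.closure S, ∀ y ∈ AddSubgroup.closure S', ⁅x, y⁆ ∈ M := by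
  intro x hx y hy
  induction hx using AddSubgroup.closure_induction with
  | mem x hx =>
    induction hy using AddSubgroup.closure_induction with
    | mem y hy => exact hM x hx y hy
    | zero => rw [lie_zero]; exact M.zero_mem
    | add a b _ _ ha hb => rw [lie_add]; exact M.add_mem ha hb
    | neg a _ ha => rw [lie_neg]; exact M.neg_mem ha
  | zero => rw [zero_lie]; exact M.zero_mem
  | add a b _ _ ha hb => rw [add_lie]; exact M.add_mem ha hb
  | neg a _ ha => rw [neg_lie]; exact M.neg_mem ha

theorem typed (h : GrData G p R D ψ) (hA : Act G e d T) : Typed (R := R) (Ls D ψ d) := by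
  have hc : ∀ s : Fin 3, ∀ x ∈ Ls D ψ d s, ∀ y ∈ Ls D ψ d s, ⁅x, y⁆ = 0 := by
    intro s x hx y hy
    rw [← AddSubgroup.mem_bot]
    refine closure_lie _ _ ⊥ ?_ x hx y hy
    rintro _ ⟨i, hi, x, hx, hsx, rfl⟩ _ ⟨j, hj, y, hy, hsy, rfl⟩
    rw [AddSubgroup.mem_bot, Ring.lie_def, ← h.bracket i j hi hj x hx y hy, hA.commute hsx hsy]
    rw [mul_inv_cancel_right, mul_inv_cancel, h.one (by omega)]
  refine ⟨?_, hc⟩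
  intro s t x hx y hy
  by_cases hst : s = t
  · subst hst; rw [hc s x hx y hy]; exact AddSubgroup.zero_mem _
  refine closure_lie _ _ _ ?_ x hx y hy
  rintro _ ⟨i, hi, x, hx, hsx, rfl⟩ _ ⟨j, hj, y, hy, hsy, rfl⟩
  obtain ⟨m, hm, h1, h2⟩ := h.bracket_lift hA hi hj hx hy hst hsx hsy (D (i + j)) (fun _ h => h)
    (fun σ g hg => h.D_char σ _ g hg) (h.D_comm i j hi hj x hx y hy)
  rw [Ring.lie_def, ← h2]
  exact AddSubgroup.subset_closure ⟨i + j, by omega, m, hm, h1, rfl⟩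

theorem mem_Ls {i : ℕ} (hi : 1 ≤ i) {x : G} (hx : x ∈ D i) {s : Fin 3} (hs : d s x = x) :
    ψ i x ∈ Ls D ψ d s := AddSubgroup.subset_closure ⟨i, hi, x, hx, hs, rfl⟩



theorem half (hA : Act G e d T) (H : Subgroup G) {g : G} (hg : g ∈ H) :
    ∃ g1 ∈ H, g1 * g1 = g ∧ ∀ σ : MulAut G, σ g = g → σ g1 = g1 := by
  obtain ⟨k, hk⟩ := odd_sqrt (G := G) hA.odd
  exact ⟨g ^ k, H.pow_mem hg k, hk g, fun σ h => by rw [map_pow, h]⟩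

theorem nilT (h : GrData G p R D ψ) (hA : Act G e d T) (he : 0 < e) {i : ℕ} (hi : 1 ≤ i) {g : G}
    (hg : g ∈ D i) (u : Fin 3) (hu : ψ i (T u g) = ψ i g) : ψ i g ^ e = 0 := by
  obtain ⟨g', hg', h1, h2⟩ := h.liftψ hA.odd (T u) (hA.TT u) hi (D i) (fun _ h => h)
    (fun g hg => h.D_char _ _ g hg) hg hu
  rw [← h2]
  exact h.pow i hi g' hg' e he (hA.eT u g' h1)

theorem nilTd (h : GrData G p R D ψ) (hA : Act G e d T) (he : 0 < e) {i : ℕ} (hi : 1 ≤ i) {g : G}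
    (hg : g ∈ D i) (u : Fin 3) (hu : ψ i (T u (d u g)) = ψ i g) : ψ i g ^ e = 0 := by
  obtain ⟨g', hg', h1, h2⟩ := h.liftψ hA.odd (T u * d u) (fun x => by
      rw [MulAut.mul_apply, MulAut.mul_apply, hA.Td u u x, f3e, hA.dd, hA.TT]) hi (D i)
    (fun _ h => h) (fun g hg => h.D_char _ _ g hg) hg hu
  rw [← h2]
  exact h.pow i hi g' hg' e he (hA.eTd u g' h1)

theorem two_nil (h : GrData G p R D ψ) (hA : Act G e d T) (he : 0 < e) {i : ℕ} (hi : 1 ≤ i)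
    (H : Subgroup G) (hH : ∀ g ∈ H, g ∈ D i) (hθH : ∀ (σ : MulAut G), ∀ g ∈ H, σ g ∈ H) {x : G}
    (hx : x ∈ H) {s : Fin 3} (hs : d s x = x) :
    ∃ a ∈ H, ∃ b ∈ H, ψ i x = ψ i a + ψ i b ∧ ψ i a ^ e = 0 ∧ ψ i b ^ e = 0 := by
  obtain ⟨y, hy, rfl, hyf⟩ := half hA H hx
  have hsy : d s y = y := hyf _ hs
  have hT : T (s + 1) y ∈ H := hθH _ _ hy
  have hTi := H.inv_mem hT
  refine ⟨y * T (s + 1) y, H.mul_mem hy hT, y * (T (s + 1) y)⁻¹, H.mul_mem hy hTi, ?_, ?_, ?_⟩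
  · rw [h.add i hi _ (hH _ hy) _ (hH _ hy), h.add i hi _ (hH _ hy) _ (hH _ hT),
      h.add i hi _ (hH _ hy) _ (hH _ hTi), h.inv hi (hH _ hT)]
    abel
  · refine h.nilT hA he hi (hH _ (H.mul_mem hy hT)) (s + 1) ?_
    rw [map_mul, hA.TT, h.add i hi _ (hH _ hy) _ (hH _ hT), h.add i hi _ (hH _ hT) _ (hH _ hy)]
    abel
  · refine h.nilTd hA he hi (hH _ (H.mul_mem hy hTi)) (s + 1) ?_
    have e1 : T (s + 1) (d (s + 1) (y * (T (s + 1) y)⁻¹)) = (T (s + 1) y)⁻¹ * y := by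
      have := hA.Td (s + 1) (s + 1) y
      rw [f3e] at this
      rw [map_mul, map_inv, ← this, map_mul, map_inv, hA.TT, hA.inv (f3g s) hsy, map_inv, inv_inv]
    rw [e1, h.add i hi _ (hH _ hy) _ (hH _ hTi), h.add i hi _ (hH _ hTi) _ (hH _ hy)]
    abel

theorem sum3_zero (h : GrData G p R D ψ) (hA : Act G e d T) {i : ℕ} (hi : 1 ≤ i) {n : G}
    (hn : n ∈ D i) (hd : ∀ s, ψ i (d s n) = ψ i n) : ψ i n = 0 := by
  obtain ⟨g', hg', h1, h2⟩ := h.liftψ hA.odd (d 0) (hA.dd 0) hi (D i) (fun _ h => h)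
    (fun g hg => h.D_char _ _ g hg) hn (hd 0)
  have h3 := h.congrσ hi hg' hn (d 1) h2
  rw [hd, hA.inv (by decide : (0 : Fin 3) ≠ 1) h1, h.inv hi hg', h2] at h3
  apply h.two
  rw [two_smul]
  nth_rw 1 [← h3]
  simp

theorem sum3 (h : GrData G p R D ψ) (hA : Act G e d T) {i : ℕ} (hi : 1 ≤ i)
    (H : Subgroup G) (hH : ∀ g ∈ H, g ∈ D i) (hθH : ∀ (σ : MulAut G), ∀ g ∈ H, σ g ∈ H) {g : G}
    (hg : g ∈ H) :
    ∃ k : Fin 3 → G, (∀ s, k s ∈ H ∧ d s (k s) = k s) ∧ ψ i g = ψ i (k 0) + ψ i (k 1) + ψ i (k 2) := by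
  obtain ⟨g2, hg2, rfl, -⟩ := half hA H hg
  obtain ⟨g1, hg1, rfl, -⟩ := half hA H hg2
  have hds : ∀ s, d s g1 ∈ H := fun s => hθH _ _ hg1
  have hm : ∀ s, g1 * d s g1 * (d (s + 1) g1)⁻¹ * (d (s + 2) g1)⁻¹ ∈ H := fun s =>
    H.mul_mem (H.mul_mem (H.mul_mem hg1 (hds _)) (H.inv_mem (hds _))) (H.inv_mem (hds _))
  have hadd : ∀ a ∈ H, ∀ b ∈ H, ψ i (a * b) = ψ i a + ψ i b := fun a ha b hb =>
    h.add i hi a (hH _ ha) b (hH _ hb)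
  have hinv : ∀ a ∈ H, ψ i a⁻¹ = - ψ i a := fun a ha => h.inv hi (hH _ ha)
  have hadd4 : ∀ a ∈ H, ∀ b ∈ H, ∀ c ∈ H, ∀ f ∈ H,
      ψ i (a * b * c * f) = ψ i a + ψ i b + ψ i c + ψ i f := fun a ha b hb c hc f hf => by
    rw [hadd _ (H.mul_mem (H.mul_mem ha hb) hc) _ hf, hadd _ (H.mul_mem ha hb) _ hc,
      hadd _ ha _ hb]
  have hmv : ∀ s, ψ i (g1 * d s g1 * (d (s + 1) g1)⁻¹ * (d (s + 2) g1)⁻¹) =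
      ψ i g1 + ψ i (d s g1) - ψ i (d (s + 1) g1) - ψ i (d (s + 2) g1) := fun s => by
    rw [hadd4 _ hg1 _ (hds _) _ (H.inv_mem (hds _)) _ (H.inv_mem (hds _)), hinv _ (hds _),
      hinv _ (hds _)]
    abel
  have hk : ∀ s, ∃ k ∈ H, d s k = k ∧
      ψ i k = ψ i g1 + ψ i (d s g1) - ψ i (d (s + 1) g1) - ψ i (d (s + 2) g1) := by
    intro s
    rw [← hmv]
    refine h.liftψ hA.odd (d s) (hA.dd s) hi H hH (hθH _) (hm s) ?_
    have e1 : d s (d (s + 1) g1) = d (s + 2) g1 := by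
      rw [hA.dt _ _ _ (f3g s), add_comm s (s + 1), ← f3j]
    have e2 : d s (d (s + 2) g1) = d (s + 1) g1 := by
      rw [hA.dt _ _ _ (f3h s), add_comm s (s + 2), ← f3k]
    rw [map_mul, map_mul, map_mul, map_inv, map_inv, hA.dd, e1, e2, hmv,
      hadd4 _ (hds _) _ hg1 _ (H.inv_mem (hds _)) _ (H.inv_mem (hds _)), hinv _ (hds _),
      hinv _ (hds _)]
    abel
  choose k hk1 hk2 hk3 using hk
  have hN : ψ i (g1 * d 0 g1 * d 1 g1 * d 2 g1) = 0 := by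
    refine h.sum3_zero hA hi (hH _ (H.mul_mem (H.mul_mem (H.mul_mem hg1 (hds _)) (hds _)) (hds _))) ?_
    intro s
    rw [map_mul, map_mul, map_mul, hadd4 _ (hds _) _ (hθH _ _ (hds _)) _ (hθH _ _ (hds _)) _
      (hθH _ _ (hds _)), hadd4 _ hg1 _ (hds _) _ (hds _) _ (hds _)]
    have q : ∀ a b c : Fin 3, a ≠ b → c = -(a + b) → d a (d b g1) = d c g1 := fun a b c hab hc => by
      rw [hA.dt a b _ hab, hc]
    fin_cases s
    · simp only [Fin.zero_eta]
      rw [hA.dd, q 0 1 2 (by decide) (by decide), q 0 2 1 (by decide) (by decide)]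
      abel
    · simp only [Fin.mk_one]
      rw [hA.dd, q 1 0 2 (by decide) (by decide), q 1 2 0 (by decide) (by decide)]
      abel
    · simp only [Fin.reduceFinMk]
      rw [hA.dd, q 2 0 1 (by decide) (by decide), q 2 1 0 (by decide) (by decide)]
      abel
  rw [hadd4 _ hg1 _ (hds _) _ (hds _) _ (hds _)] at hN
  refine ⟨k, fun s => ⟨hk1 s, hk2 s⟩, ?_⟩
  rw [hk3, hk3, hk3, hadd _ hg2 _ hg2, hadd _ hg1 _ hg1]
  have e1 : (0 : Fin 3) + 1 = 1 := rfl
  have e2 : (0 : Fin 3) + 2 = 2 := rfl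
  have e3 : (1 : Fin 3) + 1 = 2 := rfl
  have e4 : (1 : Fin 3) + 2 = 0 := rfl
  have e5 : (2 : Fin 3) + 1 = 0 := rfl
  have e6 : (2 : Fin 3) + 2 = 1 := rfl
  rw [e1, e2, e3, e4, e5, e6]
  rw [← sub_eq_zero]
  rw [← hN]
  abel

theorem gen_split (h : GrData G p R D ψ) (hA : Act G e d T) {i : ℕ} (hi : 1 ≤ i) {x : G}
    (hx : x ∈ D i) {s : Fin 3} (hs : d s x = x) :
    ∃ a ∈ D i, ∃ b ∈ D i, ψ i x = ψ i a + ψ i b ∧ d s a = a ∧ d s b = b ∧ T s a = a ∧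
      T s b = b⁻¹ := by
  obtain ⟨y, hy, rfl, hyf⟩ := half hA (D i) hx
  have hsy : d s y = y := hyf _ hs
  have hT : T s y ∈ D i := h.D_char _ _ _ hy
  have hTi := (D i).inv_mem hT
  have hsT : d s (T s y) = T s y := hA.dT (f3e s).symm hsy
  refine ⟨y * T s y, (D i).mul_mem hy hT, y * (T s y)⁻¹, (D i).mul_mem hy hTi, ?_, ?_, ?_, ?_, ?_⟩
  · rw [h.add i hi _ hy _ hy, h.add i hi _ hy _ hT, h.add i hi _ hy _ hTi, h.inv hi hT]
    abel
  · rw [map_mul, hsy, hsT]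
  · rw [map_mul, map_inv, hsy, hsT]
  · rw [map_mul, hA.TT, hA.commute hsy hsT]
  · rw [map_mul, map_inv, hA.TT, mul_inv_rev, inv_inv]

theorem ad_nil (u : R) (q : ℕ) (hu : u ^ q = 0) : Tri.ad u ^ (2 * q) = 0 := by
  have e1 : Tri.ad u = LinearMap.mulLeft ℤ u + -LinearMap.mulRight ℤ u := by
    ext v
    simp [LieAlgebra.ad_apply, Ring.lie_def, sub_eq_add_neg]
  have hc : Commute (LinearMap.mulLeft ℤ u) (LinearMap.mulRight ℤ u) :=
    LinearMap.commute_mulLeft_right u u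
  rw [e1]
  refine Commute.add_pow_eq_zero_of_add_le_succ_of_pow_eq_zero (m := q) (n := q)
    hc.neg_right ?_ ?_ (by omega)
  · rw [LinearMap.pow_mulLeft, hu, LinearMap.mulLeft_zero_eq_zero]
  · rw [neg_pow, LinearMap.pow_mulRight, hu, LinearMap.mulRight_zero_eq_zero, mul_zero]

theorem gen_nil (h : GrData G p R D ψ) (hA : Act G e d T) (he : 0 < e) {i : ℕ} (hi : 1 ≤ i) {x : G}
    (hx : x ∈ D i) {s : Fin 3} (hs : d s x = x) (hT : T s x = x ∨ T s x = x⁻¹) :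
    ∀ r : Fin 3, ∀ u ∈ Ls D ψ d r, (Tri.ad (ψ i x) ^ (18 * e + 20)) u = 0 := by
  set y := T (s + 1) x with hydef
  set z := T (s + 2) x with hzdef
  have hy : y ∈ D i := h.D_char _ _ _ hx
  have hz : z ∈ D i := h.D_char _ _ _ hx
  have hdy : d (s + 2) y = y := hA.dT (f3j s) hs
  have hdz : d (s + 1) z = z := hA.dT (f3k s) hs
  have hxy : (ψ i x + ψ i y) ^ e = 0 := by
    rw [← h.add i hi x hx y hy]
    refine h.nilT hA he hi ((D i).mul_mem hx hy) (s + 1) ?_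
    rw [map_mul, hA.TT, h.add i hi _ hy _ hx, h.add i hi _ hx _ hy, add_comm]
  have hxz : (ψ i x + ψ i z) ^ e = 0 := by
    rw [← h.add i hi x hx z hz]
    refine h.nilT hA he hi ((D i).mul_mem hx hz) (s + 2) ?_
    rw [map_mul, hA.TT, h.add i hi _ hz _ hx, h.add i hi _ hx _ hz, add_comm]
  have hb : T s (T (s + 1) (T s x)) = z⁻¹ := by
    rw [hA.braid, hA.inv (f3h s) hs, map_inv]
  have hyz : (ψ i y + ψ i z) ^ e = 0 := by
    rw [← h.add i hi y hy z hz]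
    rcases hT with hT | hT
    · rw [hT] at hb
      have hb2 : T s z = y⁻¹ := by
        rw [← inv_inv z, ← hb, map_inv, hA.TT]
      refine h.nilTd hA he hi ((D i).mul_mem hy hz) s ?_
      rw [map_mul, map_mul, hA.inv (f3h s).symm hdy, hA.inv (f3g s).symm hdz, map_inv, map_inv,
        hb2, hb, inv_inv, inv_inv, h.add i hi _ hz _ hy, h.add i hi _ hy _ hz, add_comm]
    · rw [hT, map_inv, map_inv, inv_inj] at hb
      have hb2 : T s z = y := by
        rw [← hb, hA.TT]
      refine h.nilT hA he hi ((D i).mul_mem hy hz) s ?_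
      rw [map_mul, hb2, hb, h.add i hi _ hz _ hy, h.add i hi _ hy _ hz, add_comm]
  intro r u hu
  refine ((h.typed hA).tri (f3h s) (f3i s).symm (f3g s).symm).nil_all (mem_Ls hi hx hs)
    (mem_Ls hi hy hdy) (mem_Ls hi hz hdz) e (ad_nil _ _ hxy) (ad_nil _ _ hyz) (ad_nil _ _ hxz)
    h.two u ?_
  rcases f3l s r with rfl | rfl | rfl
  · exact Or.inl hu
  · exact Or.inr (Or.inr hu)
  · exact Or.inr (Or.inl hu)


/-- Elements spanning the piece of degree `k + 1`. -/
def MM (ψ : ℕ → G → R) (k : ℕ) : Submodule ℤ R := Submodule.span ℤ (ψ (k + 1) '' gm G k)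

theorem gens (h : GrData G p R D ψ) (hA : Act G e d T) (g : G) :
    ∃ X : Fin 3 × Bool → G, (∀ c, d c.1 (X c) = X c ∧ (T c.1 (X c) = X c ∨ T c.1 (X c) = (X c)⁻¹)) ∧
      ψ 1 g = ∑ c, ψ 1 (X c) := by
  have hD1 : ∀ g, g ∈ D 1 := fun g => by rw [h.D_one]; exact Subgroup.mem_top g
  obtain ⟨k, hk, hg⟩ := h.sum3 hA le_rfl (D 1) (fun _ h => h) (fun _ g _ => hD1 _) (hD1 g)
  have h2 := fun s => h.gen_split hA le_rfl (hk s).1 (hk s).2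
  choose a _ b _ h3 h4 h5 h6 h7 using h2
  refine ⟨fun c => if c.2 then a c.1 else b c.1, ?_, ?_⟩
  · rintro ⟨s, c⟩
    cases c
    · exact ⟨h5 s, Or.inr (h7 s)⟩
    · exact ⟨h4 s, Or.inl (h6 s)⟩
  · rw [Fintype.sum_prod_type, Fin.sum_univ_three, hg, h3, h3, h3]
    simp

theorem exists_gens (h : GrData G p R D ψ) (hA : Act G e d T) (O : Finset G) (N : ℕ)
    (hO : O.card ≤ N) (hcl : Subgroup.closure (O : Set G) = ⊤) :
    ∃ 𝒢 : Finset (Fin 3 × R), 𝒢.card ≤ 6 * N ∧ (∀ q ∈ 𝒢, ∃ x, d q.1 x = x ∧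
      (T q.1 x = x ∨ T q.1 x = x⁻¹) ∧ q.2 = ψ 1 x) ∧
      ∀ g, ψ 1 g ∈ Submodule.span ℤ {v | ∃ q ∈ 𝒢, q.2 = v} := by
  classical
  have hD1 : ∀ g, g ∈ D 1 := fun g => by rw [h.D_one]; exact Subgroup.mem_top g
  choose X hX1 hX2 using h.gens hA
  refine ⟨(O ×ˢ (Finset.univ : Finset (Fin 3 × Bool))).image (fun c => (c.2.1, ψ 1 (X c.1 c.2))),
    ?_, ?_, ?_⟩
  · refine Finset.card_image_le.trans ?_
    rw [Finset.card_product]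
    have : (Finset.univ : Finset (Fin 3 × Bool)).card = 6 := rfl
    rw [this]
    omega
  · intro q hq
    obtain ⟨c, -, rfl⟩ := Finset.mem_image.1 hq
    exact ⟨X c.1 c.2, (hX1 c.1 c.2).1, (hX1 c.1 c.2).2, rfl⟩
  · intro g
    have hg : g ∈ Subgroup.closure (O : Set G) := by rw [hcl]; exact Subgroup.mem_top g
    induction hg using Subgroup.closure_induction with
    | mem v hv =>
      rw [hX2]
      refine Submodule.sum_mem _ fun c _ => Submodule.subset_span ⟨(c.1, ψ 1 (X v c)), ?_, rfl⟩
      exact Finset.mem_image.2 ⟨(v, c), Finset.mem_product.2 ⟨hv, Finset.mem_univ _⟩, rfl⟩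
    | one => rw [h.one le_rfl]; exact Submodule.zero_mem _
    | mul a b _ _ ha hb =>
      rw [h.add 1 le_rfl a (hD1 _) b (hD1 _)]; exact Submodule.add_mem _ ha hb
    | inv a _ ha => rw [h.inv le_rfl (hD1 _)]; exact Submodule.neg_mem _ ha

theorem span_lie {R : Type} [LieRing R] (S S' : Set R) (M : Submodule ℤ R)
    (hM : ∀ x ∈ S, ∀ y ∈ S', ⁅x, y⁆ ∈ M) :
    ∀ x ∈ Submodule.span ℤ S, ∀ y ∈ Submodule.span ℤ S', ⁅x, y⁆ ∈ M := by
  intro x hx y hy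
  rw [← Submodule.mem_toAddSubgroup, Submodule.span_int_eq_addSubgroupClosure] at hx hy
  exact closure_lie S S' M.toAddSubgroup hM x hx y hy

theorem bracket1 (h : GrData G p R D ψ) {k : ℕ} (g : G) {x : G} (hx : x ∈ gm G k) :
    ⁅ψ 1 g, ψ (k + 1) x⁆ = ψ (k + 1 + 1) (g * x * g⁻¹ * x⁻¹) := by
  rw [Ring.lie_def, show k + 1 + 1 = 1 + (k + 1) by omega,
    h.bracket 1 (k + 1) le_rfl (by omega) g (by rw [h.D_one]; trivial) x (h.gm_le k x hx)]

theorem span_words (h : GrData G p R D ψ) (𝒢 : Finset (Fin 3 × R))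
    (hs : ∀ g, ψ 1 g ∈ Submodule.span ℤ {v | ∃ q ∈ 𝒢, q.2 = v}) (k : ℕ) :
    MM ψ k ≤ Submodule.span ℤ {v | ∃ σ, Typed.Word 𝒢 k σ v} := by
  induction k with
  | zero =>
    refine Submodule.span_le.2 ?_
    rintro _ ⟨g, -, rfl⟩
    refine Submodule.span_mono ?_ (hs g)
    rintro _ ⟨q, hq, rfl⟩
    exact ⟨q.1, Typed.Word.base q hq⟩
  | succ k ih =>
    refine Submodule.span_le.2 ?_
    rintro _ ⟨g, hg, rfl⟩
    rw [SetLike.mem_coe] at hg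
    have hle : ∀ x ∈ Subgroup.closure {v | ∃ g : G, ∃ h ∈ gm G k, v = g * h * g⁻¹ * h⁻¹},
      x ∈ D (k + 1 + 1) := h.gm_le (k + 1)
    rw [gm] at hg
    rw [SetLike.mem_coe]
    induction hg using Subgroup.closure_induction with
    | mem v hv =>
      obtain ⟨g, x, hx, rfl⟩ := hv
      rw [← h.bracket1 g hx]
      refine span_lie _ _ _ ?_ _ (hs g) _ (ih (Submodule.subset_span ⟨x, hx, rfl⟩))
      rintro _ ⟨q, hq, rfl⟩ y ⟨σ, hy⟩
      exact Submodule.subset_span ⟨_, Typed.Word.step q hq k σ y hy⟩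
    | one => rw [h.one (by omega)]; exact Submodule.zero_mem _
    | mul a b ha' hb' ha hb =>
      rw [h.add _ (by omega) a (hle _ ha') b (hle _ hb')]; exact Submodule.add_mem _ ha hb
    | inv a ha' ha => rw [h.inv (by omega) (hle _ ha')]; exact Submodule.neg_mem _ ha

theorem word_elem (h : GrData G p R D ψ) (hA : Act G e d T) (𝒢 : Finset (Fin 3 × R))
    (h𝒢 : ∀ q ∈ 𝒢, ∃ x, d q.1 x = x ∧ (T q.1 x = x ∨ T q.1 x = x⁻¹) ∧ q.2 = ψ 1 x)
    {k : ℕ} {σ : Fin 3} {v : R} (hv : Typed.Word 𝒢 k σ v) :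
    ∃ x ∈ gm G k, d σ x = x ∧ v = ψ (k + 1) x := by
  induction hv with
  | base q hq =>
    obtain ⟨x, hx, -, h2⟩ := h𝒢 q hq
    exact ⟨x, Subgroup.mem_top _, hx, h2⟩
  | step q hq n σ v _ ih =>
    obtain ⟨g, hg, -, h2⟩ := h𝒢 q hq
    obtain ⟨x, hx, hx1, hx2⟩ := ih
    rw [h2, hx2]
    have hD1 : g ∈ D 1 := by rw [h.D_one]; exact Subgroup.mem_top g
    have hgm : g * x * g⁻¹ * x⁻¹ ∈ gm G (n + 1) := by
      rw [gm]; exact Subgroup.subset_closure ⟨g, x, hx, rfl⟩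
    by_cases hσ : q.1 = σ
    · rw [hσ] at hg
      refine ⟨1, Subgroup.one_mem _, map_one _, ?_⟩
      rw [h.bracket1 g hx, hA.commute hg hx1, mul_inv_cancel_right, mul_inv_cancel]
    · have e1 : 1 + (n + 1) = n + 1 + 1 := by omega
      obtain ⟨m, hm, hm1, hm2⟩ := h.bracket_lift hA le_rfl (by omega : 1 ≤ n + 1) hD1
        (h.gm_le n x hx) hσ hg hx1 (gm G (n + 1)) (fun y hy => e1 ▸ h.gm_le (n + 1) y hy)
        (fun τ y hy => gm_char τ _ y hy) hgm
      rw [e1] at hm2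
      exact ⟨m, hm, hm1, by rw [hm2, Ring.lie_def]⟩

theorem word_MM (h : GrData G p R D ψ) (hA : Act G e d T) (𝒢 : Finset (Fin 3 × R))
    (h𝒢 : ∀ q ∈ 𝒢, ∃ x, d q.1 x = x ∧ (T q.1 x = x ∨ T q.1 x = x⁻¹) ∧ q.2 = ψ 1 x)
    {k : ℕ} {σ : Fin 3} {v : R} (hv : Typed.Word 𝒢 k σ v) :
    ∀ j, ∀ y ∈ MM ψ j, ⁅v, y⁆ ∈ MM ψ (k + j + 1) := by
  have key : ∀ q ∈ 𝒢, ∀ j, ∀ y ∈ MM ψ j, ⁅q.2, y⁆ ∈ MM ψ (j + 1) := by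
    intro q hq j y hy
    obtain ⟨g, -, -, h2⟩ := h𝒢 q hq
    refine span_lie {q.2} _ _ ?_ _ (Submodule.mem_span_singleton_self _) _ hy
    rintro x hx _ ⟨z, hz, rfl⟩
    rw [Set.mem_singleton_iff] at hx
    rw [hx, h2, h.bracket1 g hz]
    refine Submodule.subset_span ⟨_, ?_, rfl⟩
    rw [gm]; exact Subgroup.subset_closure ⟨g, z, hz, rfl⟩
  induction hv with
  | base q hq => intro j y hy; rw [zero_add]; exact key q hq j y hy
  | step q hq n σ v _ ih =>
    intro j y hy
    have e1 : ⁅⁅q.2, v⁆, y⁆ = ⁅q.2, ⁅v, y⁆⁆ - ⁅v, ⁅q.2, y⁆⁆ := lie_lie _ _ _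
    rw [e1]
    have h1 := key q hq _ _ (ih j y hy)
    have h2 := ih (j + 1) _ (key q hq j y hy)
    rw [show n + j + 1 + 1 = n + 1 + j + 1 by omega] at h1
    rw [show n + (j + 1) + 1 = n + 1 + j + 1 by omega] at h2
    exact Submodule.sub_mem _ h1 h2

theorem word_finset (𝒢 : Finset (Fin 3 × R)) (N : ℕ) (hN : 𝒢.card ≤ N) (k : ℕ) :
    ∃ W : Finset R, W.card ≤ N ^ (k + 1) ∧ ∀ σ v, Typed.Word 𝒢 k σ v → v ∈ W := by
  classical
  induction k with
  | zero =>
    refine ⟨𝒢.image Prod.snd, Finset.card_image_le.trans (by simpa using hN), ?_⟩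
    rintro σ v hv
    cases hv with
    | base q hq => exact Finset.mem_image_of_mem _ hq
  | succ k ih =>
    obtain ⟨W, hW, hW2⟩ := ih
    refine ⟨Finset.image₂ (fun q v => ⁅q.2, v⁆) 𝒢 W, ?_, ?_⟩
    · refine (Finset.card_image₂_le _ _ _).trans ?_
      rw [pow_succ N (k + 1), mul_comm]
      exact Nat.mul_le_mul hW hN
    · intro σ v hv
      cases hv with
      | step q hq n σ v hv => exact Finset.mem_image₂_of_mem hq (hW2 _ _ hv)

/-- Length after which all words vanish. -/
def KB (e : ℕ) : ℕ := 3 * (3 * 144 * (18 * e + 20) + 1)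

/-- Number of nilpotent generators in each degree. -/
def DB (e : ℕ) : ℕ := 2 * 144 ^ (KB e + 1)

/-- Bound for the nilpotency index. -/
def NB (e : ℕ) : ℕ := e ^ (DB e * KB e)

theorem pgroup_bound (h : GrData G p R D ψ) (hA : Act G e d T) (he : 0 < e) (O : Finset G)
    (hO : O.card ≤ 24) (hcl : Subgroup.closure (O : Set G) = ⊤) (s : ℕ) (hs : NB e ≤ p ^ s) (g : G) :
    g ^ (p ^ s) = 1 := by
  classical
  obtain ⟨𝒢, hcard, h𝒢, hspan⟩ := h.exists_gens hA O 24 hO hcl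
  have hD1 : ∀ g, g ∈ D 1 := fun g => by rw [h.D_one]; exact Subgroup.mem_top g
  have hty := h.typed hA
  have hWz : ∀ k, KB e ≤ k → ∀ σ v, Typed.Word 𝒢 k σ v → v = 0 := by
    intro k hk
    induction k, hk using Nat.le_induction with
    | base =>
      intro σ v hv
      refine hty.word_zero (𝒢 := 𝒢) ?_ (18 * e + 20) 144 hcard ?_ hv
      · intro q hq
        obtain ⟨x, hx, -, h2⟩ := h𝒢 q hq
        rw [h2]; exact mem_Ls le_rfl (hD1 x) hx
      · intro q hq
        obtain ⟨x, hx, hT, h2⟩ := h𝒢 q hq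
        rw [h2]; exact h.gen_nil hA he le_rfl (hD1 x) hx hT
    | succ k hk ih =>
      intro σ v hv
      cases hv with
      | step q hq n σ v hv => rw [ih _ _ hv, lie_zero]
  have hz : ∀ k, KB e ≤ k → MM ψ k = ⊥ := by
    intro k hk
    rw [eq_bot_iff]
    refine (h.span_words 𝒢 hspan k).trans (Submodule.span_le.2 ?_)
    rintro v ⟨σ, hv⟩
    exact hWz k hk σ v hv
  have hM : ∀ i j, ∀ x ∈ MM ψ i, ∀ y ∈ MM ψ j, ⁅x, y⁆ ∈ MM ψ (i + j + 1) := by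
    intro i j x hx y hy
    have hx' := h.span_words 𝒢 hspan i hx
    refine span_lie _ _ _ ?_ x hx' y (Submodule.subset_span hy)
    rintro v ⟨σ, hv⟩ y hy
    exact h.word_MM hA 𝒢 h𝒢 hv j y hy
  have hl : ∀ k, k < KB e → ∃ l : List R, l.length ≤ DB e ∧ MM ψ k = Submodule.span ℤ {u | u ∈ l} ∧
      ∀ u ∈ l, u ^ e = 0 := by
    intro k hk
    obtain ⟨W, hW1, hW2⟩ := word_finset 𝒢 144 hcard k
    have hab : ∀ v : R, ∃ a ∈ gm G k, ∃ b ∈ gm G k, ψ (k + 1) a ^ e = 0 ∧ ψ (k + 1) b ^ e = 0 ∧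
        ((∃ σ, Typed.Word 𝒢 k σ v) → v = ψ (k + 1) a + ψ (k + 1) b) := by
      intro v
      by_cases hv : ∃ σ, Typed.Word 𝒢 k σ v
      · obtain ⟨σ, hv⟩ := hv
        obtain ⟨x, hx, hσ, rfl⟩ := h.word_elem hA 𝒢 h𝒢 hv
        obtain ⟨a, ha, b, hb, h1, h2, h3⟩ := h.two_nil hA he (by omega) (gm G k) (h.gm_le k)
          (fun τ y hy => gm_char τ _ y hy) hx hσ
        exact ⟨a, ha, b, hb, h2, h3, fun _ => h1⟩
      · have h1 : ψ (k + 1) 1 ^ e = 0 := by rw [h.one (by omega), zero_pow he.ne']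
        exact ⟨1, Subgroup.one_mem _, 1, Subgroup.one_mem _, h1, h1, fun hc => absurd hc hv⟩
    choose a ha b hb hae hbe hsum using hab
    refine ⟨(W.image (fun v => ψ (k + 1) (a v)) ∪ W.image (fun v => ψ (k + 1) (b v))).toList,
      ?_, ?_, ?_⟩
    · rw [Finset.length_toList]
      refine (Finset.card_union_le _ _).trans ?_
      have h1 := Finset.card_image_le (s := W) (f := fun v => ψ (k + 1) (a v))
      have h2 := Finset.card_image_le (s := W) (f := fun v => ψ (k + 1) (b v))
      have h3 : 144 ^ (k + 1) ≤ 144 ^ (KB e + 1) := Nat.pow_le_pow_right (by norm_num) (by omega)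
      rw [DB]
      omega
    · apply le_antisymm
      · refine (h.span_words 𝒢 hspan k).trans (Submodule.span_le.2 ?_)
        rintro v ⟨σ, hv⟩
        have hvW := hW2 _ _ hv
        rw [hsum v ⟨σ, hv⟩]
        refine Submodule.add_mem _ (Submodule.subset_span ?_) (Submodule.subset_span ?_)
        · exact Finset.mem_toList.2 (Finset.mem_union_left _ (Finset.mem_image_of_mem _ hvW))
        · exact Finset.mem_toList.2 (Finset.mem_union_right _ (Finset.mem_image_of_mem _ hvW))
      · refine Submodule.span_le.2 ?_
        intro u hu
        rcases Finset.mem_union.1 (Finset.mem_toList.1 hu) with hu | hu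
        · obtain ⟨v, -, rfl⟩ := Finset.mem_image.1 hu
          exact Submodule.subset_span ⟨_, ha v, rfl⟩
        · obtain ⟨v, -, rfl⟩ := Finset.mem_image.1 hu
          exact Submodule.subset_span ⟨_, hb v, rfl⟩
    · intro u hu
      rcases Finset.mem_union.1 (Finset.mem_toList.1 hu) with hu | hu
      · obtain ⟨v, -, rfl⟩ := Finset.mem_image.1 hu
        exact hae v
      · obtain ⟨v, -, rfl⟩ := Finset.mem_image.1 hu
        exact hbe v
  have hfin := nilprod_graded (fun i => MM ψ (i - 1)) e (DB e) (KB e + 1) he (by omega) ?_ ?_ ?_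
  · refine h.final (NB e) (Nat.pow_pos he) ?_ s hs g
    have : Submodule.span ℤ (Set.range (ψ 1)) = MM ψ 0 := by
      rw [MM, gm, Subgroup.coe_top, Set.image_univ]
    rw [this]
    exact hfin
  · intro i j hi hj x hx y hy
    have := hM _ _ x hx y hy
    rw [show i - 1 + (j - 1) + 1 = i + j - 1 by omega, Ring.lie_def] at this
    exact this
  · intro i hi
    exact hz _ (by omega)
  · intro i hi hi2
    exact hl _ (by omega)


end GrData

end PGroup

section Involutions

theorem card_fixed_mod_two {X : Type} [Finite X] (f : X → X) (hf : ∀ x, f (f x) = x) :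
    Nat.card X ≡ Nat.card {x // f x = x} [MOD 2] := by
  classical
  have := Fintype.ofFinite X
  let F : Function.End X := f
  have hF : F ^ 2 ^ 1 = 1 := by
    rw [pow_one, pow_two]
    funext x
    exact hf x
  have := Equiv.Perm.card_fixedPoints_modEq (p := 2) hF
  rw [Nat.card_eq_fintype_card, Nat.card_eq_fintype_card]
  exact this

theorem card_fixed_two {X : Type} [Finite X] (f g : X → X) (hf : ∀ x, f (f x) = x)
    (hg : ∀ x, g (g x) = x) (hfg : ∀ x, f (g x) = g (f x)) :
    Nat.card X ≡ Nat.card {x // f x = x ∧ g x = x} [MOD 2] := by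
  refine (card_fixed_mod_two f hf).trans ?_
  let g' : {x // f x = x} → {x // f x = x} := fun x => ⟨g x.1, by rw [hfg, x.2]⟩
  refine (card_fixed_mod_two g' (fun x => Subtype.ext (hg _))).trans ?_
  have e1 : {x : {x // f x = x} // g' x = x} ≃ {x // f x = x ∧ g x = x} :=
    { toFun := fun x => ⟨x.1.1, x.1.2, congrArg Subtype.val x.2⟩
      invFun := fun x => ⟨⟨x.1, x.2.1⟩, Subtype.ext x.2.2⟩
      left_inv := fun x => rfl
      right_inv := fun x => rfl }
  rw [Nat.card_congr e1]

end Involutions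

section SymFour

open Equiv

/-- The nontrivial elements of the four-group. -/
def dP : Fin 3 → Perm (Fin 4) :=
  ![swap 0 1 * swap 2 3, swap 0 2 * swap 1 3, swap 0 3 * swap 1 2]

/-- Three transpositions. -/
def TP : Fin 3 → Perm (Fin 4) := ![swap 0 1, swap 0 2, swap 0 3]

theorem dP_dd : ∀ s, dP s * dP s = 1 := by decide
theorem dP_dt : ∀ s t, s ≠ t → dP s * dP t = dP (-(s + t)) := by decide
theorem dP_comm : dP 0 * dP 1 = dP 1 * dP 0 := by decide
theorem TP_TT : ∀ u, TP u * TP u = 1 := by decide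
theorem TP_Td : ∀ u s, TP u * dP s = dP (-(u + s)) * TP u := by decide
theorem TP_braid : ∀ s, TP s * TP (s + 1) * TP s = TP (s + 2) * dP (s + 2) := by decide
theorem TP_swap : ∀ u, ∃ a b, a ≠ b ∧ TP u = swap a b := by decide
theorem TPd_swap : ∀ u, ∃ a b, a ≠ b ∧ TP u * dP u = swap a b := by decide
theorem dP_conj : ∀ a : Perm (Fin 4), ∀ s, ∃ t, dP s * a = a * dP t := by decide
theorem inv_class : ∀ v : Perm (Fin 4), v * v = 1 →
    v = 1 ∨ (∃ s, v = dP s) ∨ ∃ a b, a ≠ b ∧ v = swap a b := by decide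

end SymFour

section Reduction

open Equiv

/-- An action of the symmetric group on four letters as in the theorem. -/
structure S4Act (G : Type) [Group G] (e : ℕ) (ρ : Perm (Fin 4) →* MulAut G) : Prop where
  odd : Odd (Nat.card G)
  fixV : ∀ x, (∀ s, ρ (dP s) x = x) → x = 1
  fixT : ∀ a b, a ≠ b → ∀ x, ρ (swap a b) x = x → x ^ e = 1

/-- Restriction of an action to an invariant subgroup. -/
def restrAct {A G : Type} [Group A] [Group G] (ρ : A →* MulAut G) (H : Subgroup G)
    (hH : ∀ a, ∀ x ∈ H, ρ a x ∈ H) : A →* MulAut H where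
  toFun a :=
    { toFun := fun x => ⟨ρ a x.1, hH a _ x.2⟩
      invFun := fun x => ⟨ρ a⁻¹ x.1, hH a⁻¹ _ x.2⟩
      left_inv := fun x => Subtype.ext (by
        change ρ a⁻¹ (ρ a x.1) = x.1
        rw [← MulAut.mul_apply, ← map_mul, inv_mul_cancel, map_one, MulAut.one_apply])
      right_inv := fun x => Subtype.ext (by
        change ρ a (ρ a⁻¹ x.1) = x.1
        rw [← MulAut.mul_apply, ← map_mul, mul_inv_cancel, map_one, MulAut.one_apply])
      map_mul' := fun x y => Subtype.ext (map_mul (ρ a) x.1 y.1) }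
  map_one' := by
    ext x
    change ρ 1 x.1 = x.1
    rw [map_one, MulAut.one_apply]
  map_mul' a b := by
    ext x
    change ρ (a * b) x.1 = ρ a (ρ b x.1)
    rw [map_mul, MulAut.mul_apply]

namespace S4Act

variable {G : Type} [Group G] {e : ℕ} {ρ : Perm (Fin 4) →* MulAut G}

theorem restr (h : S4Act G e ρ) (H : Subgroup G) (hH : ∀ a, ∀ x ∈ H, ρ a x ∈ H) :
    S4Act H e (restrAct ρ H hH) where
  odd := h.odd.of_dvd_nat (Subgroup.card_subgroup_dvd_card H)
  fixV := fun x hx => Subtype.ext (h.fixV x.1 fun s => congrArg Subtype.val (hx s))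
  fixT := fun a b hab x hx => Subtype.ext (by
    rw [Subgroup.coe_pow, Subgroup.coe_one]
    exact h.fixT a b hab x.1 (congrArg Subtype.val hx))

theorem act (h : S4Act G e ρ) : Act G e (fun s => ρ (dP s)) (fun u => ρ (TP u)) where
  odd := h.odd
  dd := fun s x => by rw [← MulAut.mul_apply, ← map_mul, dP_dd, map_one, MulAut.one_apply]
  dt := fun s t x hst => by rw [← MulAut.mul_apply, ← map_mul, dP_dt s t hst]
  TT := fun s x => by rw [← MulAut.mul_apply, ← map_mul, TP_TT, map_one, MulAut.one_apply]
  Td := fun u s x => by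
    rw [← MulAut.mul_apply, ← map_mul, TP_Td, map_mul, MulAut.mul_apply]
  braid := fun s x => by
    rw [← MulAut.mul_apply, ← map_mul, ← MulAut.mul_apply, ← map_mul, TP_braid, map_mul,
      MulAut.mul_apply]
  fixV := h.fixV
  eT := fun u x hx => by
    obtain ⟨a, b, hab, hu⟩ := TP_swap u
    rw [hu] at hx
    exact h.fixT a b hab x hx
  eTd := fun u x hx => by
    obtain ⟨a, b, hab, hu⟩ := TPd_swap u
    rw [← MulAut.mul_apply, ← map_mul, hu] at hx
    exact h.fixT a b hab x hx

theorem trivial_of_coprime {p : ℕ} (h : S4Act G e ρ) (hG : IsPGroup p G) (hpe : Nat.Coprime p e)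
    (x : G) : x = 1 := by
  have hf : ∀ x : G, x ^ e = 1 → x = 1 := by
    intro x hx
    obtain ⟨k, hk⟩ := hG x
    have h1 := orderOf_dvd_of_pow_eq_one hx
    have h2 := orderOf_dvd_of_pow_eq_one hk
    have h3 := Nat.Coprime.eq_one_of_dvd (Nat.Coprime.coprime_dvd_left h2
      (Nat.Coprime.pow_left k hpe)) h1
    exact orderOf_eq_one_iff.1 h3
  have hi : ∀ τ : Perm (Fin 4), (∃ a b, a ≠ b ∧ τ = swap a b) → ∀ x, ρ τ x = x⁻¹ := by
    rintro _ ⟨a, b, hab, rfl⟩ x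
    obtain ⟨r, -, h1, h2⟩ := lift_fixed h.odd (ρ (swap a b)) (fun x => by
      rw [← MulAut.mul_apply, ← map_mul, swap_mul_self, map_one, MulAut.one_apply]) x ⊤
      (Subgroup.mem_top _)
    have h3 := hf _ (h.fixT a b hab _ h1)
    rw [← inv_eq_of_mul_eq_one_right h3, map_inv, h2]
  apply h.fixV
  intro u
  have h1 := hi _ (TPd_swap u) x
  rw [map_mul, MulAut.mul_apply, ← hi _ (TP_swap u) x] at h1
  exact (ρ (TP u)).injective h1

theorem sylow_smul {p : ℕ} (θ : MulAut G) (g : G) (P : Sylow p G) :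
    θ • (g • P) = θ g • (θ • P) := by
  rw [Sylow.smul_def, Sylow.smul_def, smul_smul, smul_smul]
  congr 1
  ext x
  simp

theorem sylow_unique [Finite G] {p : ℕ} [Fact p.Prime] (h : S4Act G e ρ) (P Q : Sylow p G)
    (hP : ∀ s, ρ (dP s) • P = P) (hQ : ∀ s, ρ (dP s) • Q = Q) : P = Q := by
  obtain ⟨g, hg⟩ := MulAction.exists_smul_eq G P Q
  have key : ∀ (s : Fin 3) (g : G), g • P = Q → ρ (dP s) g * g⁻¹ ∈ MulAction.stabilizer G Q := by
    intro s g hg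
    have h1 : ρ (dP s) g • P = Q := by
      have := sylow_smul (ρ (dP s)) g P
      rw [hP, hg, hQ] at this
      exact this.symm
    rw [MulAction.mem_stabilizer_iff, mul_smul, ← hg, inv_smul_smul, h1, hg]
  obtain ⟨r, hr, h1, -⟩ := lift_fixed h.odd (ρ (dP 0)) (h.act.dd 0) g _ (key 0 g hg)
  have hx : (r * g) • P = Q := by rw [mul_smul, hg]; exact hr
  have h2 := key 1 _ hx
  rw [h.act.inv (by decide : (0 : Fin 3) ≠ 1) h1] at h2
  set x := r * g
  obtain ⟨k, hk⟩ := odd_sqrt (G := G) h.odd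
  have h3 : x ∈ MulAction.stabilizer G Q := by
    have h4 := Subgroup.pow_mem _ (Subgroup.inv_mem _ h2) k
    have h5 : (x⁻¹ * x⁻¹)⁻¹ ^ k = x := by
      rw [mul_inv_rev, inv_inv, (Commute.refl x).mul_pow, hk]
    rwa [h5] at h4
  have h6 : x • P = x • Q := by rw [hx]; exact (MulAction.mem_stabilizer_iff.1 h3).symm
  exact MulAction.injective x h6

theorem sylow_exists [Finite G] (p : ℕ) [Fact p.Prime] (h : S4Act G e ρ) :
    ∃ P : Sylow p G, ∀ a, ∀ x ∈ (P : Subgroup G), ρ a x ∈ (P : Subgroup G) := by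
  have hodd : Odd (Nat.card (Sylow p G)) := by
    obtain ⟨P⟩ := (inferInstance : Nonempty (Sylow p G))
    exact h.odd.of_dvd_nat ((Sylow.card_dvd_index P).trans (Subgroup.index_dvd_card _))
  have hmul : ∀ (a b : Perm (Fin 4)) (P : Sylow p G), ρ a • ρ b • P = ρ (a * b) • P := by
    intro a b P; rw [smul_smul, map_mul]
  have hfix := card_fixed_two (X := Sylow p G) (fun P => ρ (dP 0) • P) (fun P => ρ (dP 1) • P)
    (fun P => by rw [hmul, dP_dd, map_one, one_smul]) (fun P => by rw [hmul, dP_dd, map_one, one_smul])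
    (fun P => by rw [hmul, hmul, dP_comm])
  have : Nonempty {P : Sylow p G // ρ (dP 0) • P = P ∧ ρ (dP 1) • P = P} := by
    by_contra hc
    rw [not_nonempty_iff] at hc
    have h0 : Nat.card {P : Sylow p G // ρ (dP 0) • P = P ∧ ρ (dP 1) • P = P} = 0 :=
      Nat.card_of_isEmpty
    rw [h0, Nat.modEq_zero_iff_dvd] at hfix
    exact (Nat.not_even_iff_odd.2 hodd) (even_iff_two_dvd.2 hfix)
  obtain ⟨P, hP0, hP1⟩ := this
  have hP : ∀ s, ρ (dP s) • P = P := by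
    intro s
    have : s = 0 ∨ s = 1 ∨ s = 2 := by decide +revert
    rcases this with rfl | rfl | rfl
    · exact hP0
    · exact hP1
    · rw [show dP 2 = dP 0 * dP 1 by decide, ← hmul, hP1, hP0]
  refine ⟨P, fun a x hx => ?_⟩
  have h1 : ρ a • P = P := by
    refine h.sylow_unique _ _ ?_ hP
    intro s
    obtain ⟨t, ht⟩ := dP_conj a s
    rw [hmul, ht, ← hmul, hP]
  rw [← h1, Sylow.pointwise_smul_def]
  exact Subgroup.smul_mem_pointwise_smul x (ρ a) _ hx

theorem pgroup [Finite G] {p : ℕ} [Fact p.Prime] (hp2 : p ≠ 2) (h : S4Act G e ρ) (he : 0 < e)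
    (P : Subgroup G) (hP : IsPGroup p P) (hPρ : ∀ a, ∀ x ∈ P, ρ a x ∈ P) (y : G) (hy : y ∈ P)
    (s : ℕ) (hs : GrData.NB e ≤ p ^ s) : y ^ (p ^ s) = 1 := by
  classical
  let S : Set G := Set.range (fun a => ρ a y)
  have hSP : Subgroup.closure S ≤ P := by
    rw [Subgroup.closure_le]
    rintro _ ⟨a, rfl⟩
    exact hPρ a y hy
  have hinv : ∀ a, ∀ x ∈ Subgroup.closure S, ρ a x ∈ Subgroup.closure S := by
    intro a x hx
    induction hx using Subgroup.closure_induction with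
    | mem v hv =>
      obtain ⟨b, rfl⟩ := hv
      refine Subgroup.subset_closure ⟨a * b, ?_⟩
      simp only [map_mul, MulAut.mul_apply]
    | one => rw [map_one]; exact Subgroup.one_mem _
    | mul a b _ _ ha hb => rw [map_mul]; exact Subgroup.mul_mem _ ha hb
    | inv a _ ha => rw [map_inv]; exact Subgroup.inv_mem _ ha
  have hpg : IsPGroup p (Subgroup.closure S) := hP.to_le hSP
  have hyS : y ∈ Subgroup.closure S :=
    Subgroup.subset_closure ⟨1, by simp⟩
  obtain ⟨R, hR, D, ψ, hD⟩ := exists_grData hp2 hpg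
  let f : Perm (Fin 4) → Subgroup.closure S := fun a =>
    ⟨ρ a y, Subgroup.subset_closure ⟨a, rfl⟩⟩
  have hO : ((Finset.univ.image f : Finset _) : Set (Subgroup.closure S)) =
      ((↑) : Subgroup.closure S → G) ⁻¹' S := by
    ext z
    simp only [Finset.coe_image, Finset.coe_univ, Set.image_univ, Set.mem_range, Set.mem_preimage,
      S, f]
    constructor
    · rintro ⟨a, rfl⟩; exact ⟨a, rfl⟩
    · rintro ⟨a, ha⟩; exact ⟨a, Subtype.ext ha⟩
  have := hD.pgroup_bound (h.restr _ hinv).act he (Finset.univ.image f) (by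
      refine Finset.card_image_le.trans ?_
      rw [Finset.card_univ, Fintype.card_perm, Fintype.card_fin]
      decide) (by rw [hO]; exact Subgroup.closure_closure_coe_preimage) s hs ⟨y, hyS⟩
  exact congrArg Subtype.val this

theorem exponent_dvd [Finite G] (h : S4Act G e ρ) (he : 0 < e) (g : G) :
    orderOf g ∣ (e * GrData.NB e).factorial := by
  rw [Nat.dvd_iff_prime_pow_dvd_dvd]
  intro p k hp hk
  have : Fact p.Prime := ⟨hp⟩
  rcases Nat.eq_zero_or_pos k with rfl | hk0
  · rw [pow_zero]; exact one_dvd _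
  have hpc : p ∣ Nat.card G := (dvd_pow_self p hk0.ne').trans (hk.trans (orderOf_dvd_natCard g))
  have hp2 : p ≠ 2 := by
    rintro rfl
    exact (Nat.not_even_iff_odd.2 h.odd) (even_iff_two_dvd.2 hpc)
  obtain ⟨P, hP⟩ := h.sylow_exists p
  -- an element of order `p ^ k`
  obtain ⟨x, hx⟩ : ∃ x : G, orderOf x = p ^ k := by
    refine ⟨g ^ (orderOf g / p ^ k), ?_⟩
    rw [orderOf_pow_of_dvd (Nat.div_pos (Nat.le_of_dvd (orderOf_pos g) hk) (Nat.pow_pos hp.pos)).ne'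
      (Nat.div_dvd_of_dvd hk), Nat.div_div_self hk (orderOf_pos g).ne']
  have hxp : IsPGroup p (Subgroup.zpowers x) := IsPGroup.of_card (n := k) (by
    rw [Nat.card_zpowers, hx])
  obtain ⟨Q, hQ⟩ := hxp.exists_le_sylow
  obtain ⟨c, hc⟩ := MulAction.exists_smul_eq G Q P
  have hxQ : x ∈ (Q : Subgroup G) := hQ (Subgroup.mem_zpowers x)
  have hyP : MulAut.conj c x ∈ (P : Subgroup G) := by
    rw [← hc, Sylow.coe_subgroup_smul]
    exact Subgroup.smul_mem_pointwise_smul x (MulAut.conj c) _ hxQ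
  have hy : orderOf (MulAut.conj c x) = p ^ k := by
    rw [← hx]
    exact orderOf_injective (MulAut.conj c).toMonoidHom (MulAut.conj c).injective x
  by_cases hpe : p ∣ e
  · have hex : ∃ s, GrData.NB e ≤ p ^ s := ⟨GrData.NB e, (Nat.lt_pow_self hp.one_lt).le⟩
    have h1 := Nat.find_spec hex
    have h2 : p ^ Nat.find hex ≤ e * GrData.NB e := by
      have hN : 0 < GrData.NB e := Nat.pow_pos he
      rcases Nat.eq_zero_or_pos (Nat.find hex) with h0 | h0
      · rw [h0, pow_zero]; exact Nat.mul_pos he hN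
      · have h3 := Nat.find_min hex (m := Nat.find hex - 1) (by omega)
        obtain ⟨m, hm⟩ : ∃ m, Nat.find hex = m + 1 := ⟨Nat.find hex - 1, by omega⟩
        rw [hm, Nat.add_sub_cancel] at h3
        rw [hm, pow_succ, mul_comm]
        exact Nat.mul_le_mul (Nat.le_of_dvd he hpe) (by omega)
    have h3 := h.pgroup hp2 he P P.2 hP _ hyP _ h1
    have h4 := orderOf_dvd_of_pow_eq_one h3
    rw [hy] at h4
    exact h4.trans (Nat.dvd_factorial (Nat.pow_pos hp.pos) h2)
  · have h1 := (h.restr P hP).trivial_of_coprime P.2 ((Nat.Prime.coprime_iff_not_dvd hp).2 hpe)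
      ⟨_, hyP⟩
    have h2 : MulAut.conj c x = 1 := congrArg Subtype.val h1
    rw [h2, orderOf_one] at hy
    rw [← hy]
    exact one_dvd _

end S4Act

theorem klein_contains (B : Subgroup (Perm (Fin 4))) (hn : B.Normal) (hc : Nat.card B = 4)
    (hsq : ∀ v ∈ B, v * v = 1) :
    (∀ s, dP s ∈ B) ∧ ∀ v, v * v = 1 → v ≠ 1 → v ∉ B → ∃ a b, a ≠ b ∧ v = swap a b := by
  have hns : ∀ a b, a ≠ b → swap a b ∉ B := by
    intro a b hab hB
    have hall : ∀ c d, c ≠ d → swap c d ∈ B := by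
      intro c d hcd
      obtain ⟨g, hg⟩ := isConj_iff.1 (Perm.isConj_swap hab hcd)
      rw [← hg]
      exact hn.conj_mem _ hB g
    have := hsq _ (B.mul_mem (hall 0 1 (by decide)) (hall 0 2 (by decide)))
    revert this
    decide
  have hd : ∀ s, dP s ∈ B := by
    obtain ⟨s, hs⟩ : ∃ s, dP s ∈ B := by
      by_contra! hno
      have : B = ⊥ := by
        rw [eq_bot_iff]
        intro v hv
        rcases inv_class v (hsq v hv) with h | ⟨s, rfl⟩ | ⟨a, b, hab, rfl⟩
        · exact h
        · exact absurd hv (hno s)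
        · exact absurd hv (hns a b hab)
      rw [this, Subgroup.card_bot] at hc
      omega
    intro t
    have h1 := TP_Td (-(s + t)) s
    rw [f3d] at h1
    have h2 : TP (-(s + t)) * dP s * (TP (-(s + t)))⁻¹ = dP t := by rw [h1, mul_inv_cancel_right]
    rw [← h2]
    exact hn.conj_mem _ hs _
  refine ⟨hd, fun v hv h1 hB => ?_⟩
  rcases inv_class v hv with h | ⟨s, rfl⟩ | h
  · exact absurd h h1
  · exact absurd (hd s) hB
  · exact h

theorem odd_of_fixV {G : Type} [Group G] [Finite G] (ρ : Perm (Fin 4) →* MulAut G)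
    (fixV : ∀ x, (∀ s, ρ (dP s) x = x) → x = 1) : Odd (Nat.card G) := by
  have hmul : ∀ (a b : Perm (Fin 4)) (x : G), ρ a (ρ b x) = ρ (a * b) x := by
    intro a b x; rw [map_mul, MulAut.mul_apply]
  have hfix := card_fixed_two (X := G) (fun x => ρ (dP 0) x) (fun x => ρ (dP 1) x)
    (fun P => by rw [hmul, dP_dd, map_one, MulAut.one_apply])
    (fun P => by rw [hmul, dP_dd, map_one, MulAut.one_apply])
    (fun P => by rw [hmul, hmul, dP_comm])
  have : Nat.card {x : G // ρ (dP 0) x = x ∧ ρ (dP 1) x = x} = 1 := by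
    rw [Nat.card_eq_one_iff_unique]
    refine ⟨⟨?_⟩, ⟨1, map_one _, map_one _⟩⟩
    have key : ∀ x : G, ρ (dP 0) x = x ∧ ρ (dP 1) x = x → x = 1 := by
      rintro x ⟨h0, h1⟩
      apply fixV
      intro s
      have : s = 0 ∨ s = 1 ∨ s = 2 := by
        clear * -
        decide +revert
      rcases this with rfl | rfl | rfl
      · exact h0
      · exact h1
      · rw [show dP 2 = dP 0 * dP 1 by decide, ← hmul, h1, h0]
    rintro ⟨x, hx⟩ ⟨y, hy⟩
    exact Subtype.ext ((key x hx).trans (key y hy).symm)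
  rw [this] at hfix
  rw [Nat.odd_iff]
  exact hfix

end Reduction

/-- **Theorem (Romano–Shumyatsky, Theorem 1.3).**
There is a function `f : ℕ → ℕ` such that whenever a group `A` isomorphic to the
symmetric group `S₄`, with `V` its normal Klein four-subgroup and `α` an involution
in `A \ V`, acts by automorphisms on a finite group `G` with `C_G(V) = 1` and
`C_G(α)` of exponent dividing `e > 0`, then the exponent of `G` is at most `f e`. -/
theorem exponent_bounded_of_S4_action :
    ∃ f : ℕ → ℕ,
      ∀ (A : Type) [Group A], Nonempty (A ≃* Equiv.Perm (Fin 4)) →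
      ∀ (V : Subgroup A), V.Normal → Nat.card V = 4 → (∀ v ∈ V, v * v = 1) →
      ∀ (α : A), α * α = 1 → α ≠ 1 → α ∉ V →
      ∀ (G : Type) [Group G] [Finite G] (φ : A →* MulAut G),
        (∀ x : G, (∀ v ∈ V, φ v x = x) → x = 1) →
        ∀ (e : ℕ), 0 < e →
        (∀ x : G, φ α x = x → x ^ e = 1) →
        Monoid.exponent G ≤ f e := by
  refine ⟨fun e => (e * GrData.NB e).factorial, ?_⟩
  rintro A _ ⟨ι⟩ V hV hVc hVsq α hα hα1 hαV G _ _ φ hfix e he hfe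
  let B : Subgroup (Equiv.Perm (Fin 4)) := V.map ι.toMonoidHom
  have memB : ∀ a, a ∈ B ↔ ι.symm a ∈ V := by
    intro a
    constructor
    · rintro ⟨v, hv, rfl⟩
      simpa using hv
    · intro h
      exact ⟨_, h, by simp⟩
  have hBn : B.Normal := hV.map ι.toMonoidHom ι.surjective
  have hBc : Nat.card B = 4 := by
    exact (Nat.card_congr (V.equivMapOfInjective ι.toMonoidHom ι.injective).toEquiv).symm.trans hVc
  have hBsq : ∀ v ∈ B, v * v = 1 := by
    rintro _ ⟨v, hv, rfl⟩
    rw [← map_mul, hVsq v hv, map_one]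
  obtain ⟨hd, hsw⟩ := klein_contains B hBn hBc hBsq
  obtain ⟨a, b, hab, hαs⟩ := hsw (ι α) (by rw [← map_mul, hα, map_one])
    (fun h => hα1 (by rwa [MulEquiv.map_eq_one_iff] at h))
    (fun h => hαV (by simpa using (memB _).1 h))
  let ρ : Equiv.Perm (Fin 4) →* MulAut G := φ.comp ι.symm.toMonoidHom
  have hρ : ∀ a, ρ a = φ (ι.symm a) := fun a => rfl
  have hfixV : ∀ x, (∀ s, ρ (dP s) x = x) → x = 1 := by
    intro x hx
    apply hfix
    intro v hv
    by_cases h1 : v = 1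
    · rw [h1, map_one, MulAut.one_apply]
    have hvB : ι v ∈ B := ⟨v, hv, rfl⟩
    rcases inv_class (ι v) (hBsq _ hvB) with h | ⟨s, h⟩ | ⟨c, f, hcf, h⟩
    · exact absurd (by rwa [MulEquiv.map_eq_one_iff] at h) h1
    · have := hx s
      rw [← h, hρ, MulEquiv.symm_apply_apply] at this
      exact this
    · exfalso
      obtain ⟨g, hg⟩ := isConj_iff.1 (Equiv.Perm.isConj_swap hcf hab)
      rw [← h, ← hαs] at hg
      have h2 := hBn.conj_mem _ hvB g
      rw [hg] at h2
      exact hαV (by simpa using (memB _).1 h2)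
  have hS : S4Act G e ρ :=
    { odd := odd_of_fixV ρ hfixV
      fixV := hfixV
      fixT := by
        intro c f hcf x hx
        obtain ⟨g, hg⟩ := isConj_iff.1 (Equiv.Perm.isConj_swap hab hcf)
        have h1 : ρ (Equiv.swap a b) (ρ g⁻¹ x) = ρ g⁻¹ x := by
          have h2 : Equiv.swap a b * g⁻¹ = g⁻¹ * Equiv.swap c f := by rw [← hg]; group
          rw [← MulAut.mul_apply, ← map_mul, h2, map_mul, MulAut.mul_apply, hx]
        rw [← hαs, hρ, MulEquiv.symm_apply_apply] at h1
        have h3 := hfe _ h1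
        rw [← map_pow] at h3
        exact (MulEquiv.map_eq_one_iff _).1 h3 }
  refine Nat.le_of_dvd (Nat.factorial_pos _) ?_
  exact Monoid.exponent_dvd_of_forall_pow_eq_one fun g =>
    orderOf_dvd_iff_pow_eq_one.1 (hS.exponent_dvd he g)
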